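/- Assume condition (9) and that for some integers e_1, …, e_p one has P(k_1, …, k_{i−1}, −k_i − 2r_i − n_i, k_{i+1}, …, k_p) = (−1)^{A_i(n_i+1)+e_i} P(k_1, …, k_p) for every i ∈ {1, …, p}. Then the series S(P) is a K-linear combination of multiple zeta values of depth at most p in which every multiple zeta value ζ(s_1, …, s_p) of depth exactly p appearing with a nonzero coefficient satisfies s_1 ≥ 2, 1 ≤ s_i ≤ A_i, and s_i ≡ e_i (mod 2) for every i ∈ {1, …, p}. -/

import Mathlib

/-- The multiple zeta value `ζ(s₁, …, s_q)`, defined as a sum over strictly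
decreasing tuples `k₁ > k₂ > … > k_q ≥ 1`.  For the empty list it equals `1`. -/
noncomputable def mzv (s : List ℕ) : ℝ :=
  ∑' k : {k : Fin s.length → ℕ // StrictAnti k ∧ ∀ i, 1 ≤ k i},
    ∏ i : Fin s.length, ((k.1 i : ℝ) ^ s.get i)⁻¹

/-- The rational function `P(k₁,…,k_p) / ∏ᵢ ((kᵢ+rᵢ)_{nᵢ+1})^{Aᵢ}`. -/
noncomputable def Rfun (p : ℕ) (K : Subfield ℂ) (A n r : ℕ → ℕ)
    (P : MvPolynomial (Fin p) K) (k : Fin p → ℂ) : ℂ :=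
  MvPolynomial.eval₂ K.subtype k P /
    ∏ i : Fin p, ((ascPochhammer ℂ (n i.1 + 1)).eval (k i + (r i.1 : ℂ))) ^ A i.1

/-- The nested sum of `f₁(k₁) ⋯ f_q(k_q)` over `n > k₁` and `k_{i+1} < k_i + δ`. -/
def nestedSum {R : Type*} [CommSemiring R] (δ : ℕ) : List (ℕ → R) → ℕ → R
  | [], _ => 1
  | f :: L, n => ∑ k ∈ Finset.range n, f k * nestedSum δ L (k + δ)

/-- The index condition of `nestedSum`. -/
def IsNested {p : ℕ} (δ : ℕ) (k : Fin p → ℕ) : Prop :=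
  ∀ i j, i < j → k j < k i + δ

theorem isNested_cons {p δ a : ℕ} {k : Fin p → ℕ} :
    IsNested δ (Fin.cons a k : Fin (p + 1) → ℕ) ↔ (∀ j, k j < a + δ) ∧ IsNested δ k := by
  constructor
  · intro h
    refine ⟨fun j => by simpa using h 0 j.succ (Fin.succ_pos j), fun i j hij => ?_⟩
    simpa using h i.succ j.succ (by simpa using hij)
  · rintro ⟨h1, h2⟩ i j hij
    induction i using Fin.cases with
    | zero =>
      induction j using Fin.cases with
      | zero => exact absurd hij (lt_irrefl _)
      | succ j => simpa using h1 j
    | succ i =>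
      induction j using Fin.cases with
      | zero => exact absurd hij (by simp)
      | succ j => simpa using h2 i j (by simpa using hij)

open Classical in
theorem sum_filter_isNested {R : Type*} [CommSemiring R] {δ : ℕ} (hδ : δ ≤ 1) {p : ℕ}
    (F : Fin p → ℕ → R) (n : ℕ) :
    ∑ k ∈ (Fintype.piFinset fun _ : Fin p => Finset.range n) with IsNested δ k, ∏ i, F i (k i)
      = nestedSum δ (List.ofFn F) n := by
  induction p generalizing n with
  | zero =>
    rw [Finset.filter_true_of_mem fun _ _ i => i.elim0]
    simp [nestedSum]
  | succ p ih =>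
    rw [List.ofFn_succ, nestedSum]
    simp_rw [← ih, Finset.mul_sum]
    rw [Finset.sum_sigma']
    symm
    refine Finset.sum_bij' (fun x _ => (Fin.cons x.1 x.2 : Fin (p + 1) → ℕ))
      (fun k _ => ⟨k 0, Fin.tail k⟩) ?_ ?_ ?_ ?_ ?_
    · rintro ⟨a, k⟩ h
      simp only [Finset.mem_sigma, Finset.mem_range, Finset.mem_filter,
        Fintype.mem_piFinset] at h ⊢
      refine ⟨fun i => ?_, isNested_cons.2 h.2⟩
      induction i using Fin.cases with
      | zero => simpa using h.1
      | succ i => have := h.2.1 i; simp only [Fin.cons_succ]; omega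
    · intro k h
      rw [← Fin.cons_self_tail k] at h
      simp only [Finset.mem_sigma, Finset.mem_range, Finset.mem_filter,
        Fintype.mem_piFinset] at h ⊢
      exact ⟨by simpa using h.1 0, isNested_cons.1 h.2⟩
    · rintro ⟨a, k⟩ h
      simp
    · intro k h
      exact Fin.cons_self_tail k
    · rintro ⟨a, k⟩ h
      simp [Fin.prod_univ_succ]

theorem tendsto_nestedSum {δ : ℕ} (hδ : δ ≤ 1) {p : ℕ} (F : Fin p → ℕ → ℂ) (b : ℝ)
    (hb : ∀ n, nestedSum δ (List.ofFn fun i k => ‖F i k‖) n ≤ b) :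
    Summable (fun k : {k : Fin p → ℕ // IsNested δ k} => ∏ i, F i (k.1 i)) ∧
    Filter.Tendsto (nestedSum δ (List.ofFn F)) Filter.atTop
      (nhds (∑' k : {k : Fin p → ℕ // IsNested δ k}, ∏ i, F i (k.1 i))) := by
  classical
  set S : ℕ → Finset {k : Fin p → ℕ // IsNested δ k} := fun n =>
    (Fintype.piFinset fun _ : Fin p => Finset.range n).subtype _ with hS
  have hT : Filter.Tendsto S Filter.atTop Filter.atTop := by
    refine Filter.tendsto_atTop_finset_of_monotone (fun m n hmn k hk => ?_) (fun k => ?_)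
    · simp only [hS, Finset.mem_subtype, Fintype.mem_piFinset, Finset.mem_range] at hk ⊢
      exact fun i => (hk i).trans_le hmn
    · refine ⟨∑ i, k.1 i + 1, ?_⟩
      simp only [hS, Finset.mem_subtype, Fintype.mem_piFinset, Finset.mem_range]
      exact fun i => Nat.lt_succ_of_le (Finset.single_le_sum (fun _ _ => Nat.zero_le _)
        (Finset.mem_univ i))
  have hsum : Summable (fun k : {k : Fin p → ℕ // IsNested δ k} => ∏ i, F i (k.1 i)) := by
    refine Summable.of_norm (summable_of_sum_le (c := b) (fun _ => norm_nonneg _) fun u => ?_)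
    obtain ⟨n, hn⟩ := (hT.eventually_ge_atTop u).exists
    refine (Finset.sum_le_sum_of_subset_of_nonneg hn fun _ _ _ => norm_nonneg _).trans ?_
    refine le_trans (le_of_eq ?_) (hb n)
    rw [← sum_filter_isNested hδ]
    simp only [norm_prod, hS]
    exact Finset.sum_subtype_eq_sum_filter (p := IsNested δ) (fun k => ∏ i, ‖F i (k i)‖)
  refine ⟨hsum, (hsum.hasSum.comp hT).congr fun n => ?_⟩
  rw [← sum_filter_isNested hδ]
  exact Finset.sum_subtype_eq_sum_filter (p := IsNested δ) (fun k => ∏ i, F i (k i))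

/-- Tuples of positive integers correspond to tuples of naturals by a shift. -/
def positiveTuplesEquiv {p : ℕ} (δ : ℕ) (C : (Fin p → ℕ) → Prop)
    (hC : ∀ k, C (fun i => k i + 1) ↔ IsNested δ k) :
    {k : Fin p → ℕ // IsNested δ k} ≃ {k : Fin p → ℕ // C k ∧ ∀ i, 1 ≤ k i} where
  toFun k := ⟨fun i => k.1 i + 1, (hC _).2 k.2, fun i => Nat.le_add_left _ _⟩
  invFun k := ⟨fun i => k.1 i - 1, (hC _).1 (by
    have : (fun i => k.1 i - 1 + 1) = k.1 := funext fun i => Nat.sub_add_cancel (k.2.2 i)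
    rw [this]; exact k.2.1)⟩
  left_inv k := by ext; simp
  right_inv k := by
    ext i
    exact Nat.sub_add_cancel (k.2.2 i)

theorem antitone_add_one_iff {p : ℕ} (k : Fin p → ℕ) :
    Antitone (fun i => k i + 1) ↔ IsNested 1 k := by
  constructor
  · intro h i j hij
    have := h hij.le
    simp only at this
    omega
  · intro h i j hij
    rcases hij.eq_or_lt with rfl | hij
    · exact le_rfl
    · have := h i j hij
      simp only
      omega

theorem strictAnti_add_one_iff {p : ℕ} (k : Fin p → ℕ) :
    StrictAnti (fun i => k i + 1) ↔ IsNested 0 k := by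
  constructor
  · intro h i j hij
    have := h hij
    simp only at this
    omega
  · intro h i j hij
    have := h i j hij
    simp only
    omega

theorem nestedSum_nonneg {δ : ℕ} {L : List (ℕ → ℝ)} (hL : ∀ u ∈ L, ∀ k, 0 ≤ u k) (n : ℕ) :
    0 ≤ nestedSum δ L n := by
  induction L generalizing n with
  | nil => simp [nestedSum]
  | cons u L ih =>
    rw [nestedSum]
    exact Finset.sum_nonneg fun k _ => mul_nonneg (hL u (by simp) k)
      (ih (fun v hv => hL v (by simp [hv])) _)

theorem norm_nestedSum_le {δ : ℕ} (L : List (ℕ → ℂ)) (n : ℕ) :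
    ‖nestedSum δ L n‖ ≤ nestedSum δ (L.map fun f k => ‖f k‖) n := by
  induction L generalizing n with
  | nil => simp [nestedSum]
  | cons u L ih =>
    rw [List.map_cons, nestedSum, nestedSum]
    refine (norm_sum_le _ _).trans (Finset.sum_le_sum fun k _ => ?_)
    rw [norm_mul]
    exact mul_le_mul_of_nonneg_left (ih _) (norm_nonneg _)

theorem sum_range_inv_sqrt_le (n : ℕ) :
    ∑ k ∈ Finset.range n, (√((k : ℝ) + 1))⁻¹ ≤ 2 * √(n : ℝ) := by
  induction n with
  | zero => simp
  | succ n ih =>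
    rw [Finset.sum_range_succ]
    have h1 : (0 : ℝ) < √((n : ℝ) + 1) := Real.sqrt_pos.2 (by positivity)
    have h2 : √((n : ℝ) + 1) * √((n : ℝ) + 1) = n + 1 := Real.mul_self_sqrt (by positivity)
    have h3 : √(n : ℝ) * √(n : ℝ) = n := Real.mul_self_sqrt (by positivity)
    have h4 : (√((n : ℝ) + 1))⁻¹ * √((n : ℝ) + 1) = 1 := inv_mul_cancel₀ h1.ne'
    have h5 : (√((n : ℝ) + 1))⁻¹ ≤ 2 * √((n : ℝ) + 1) - 2 * √(n : ℝ) := by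
      refine le_of_mul_le_mul_right ?_ h1
      nlinarith [sq_nonneg (√((n : ℝ) + 1) - √(n : ℝ))]
    push_cast
    linarith

/-- Growth of order at most `d`. -/
def HasGrowth (u : ℕ → ℝ) (d : ℤ) : Prop :=
  (∀ k, 0 ≤ u k) ∧ ∃ C, 0 ≤ C ∧ ∀ k, u k ≤ C * ((k : ℝ) + 1) ^ d

theorem zpow_mul_nestedSum_le (L : List ((ℕ → ℝ) × ℤ)) (x : ℤ)
    (hL : ∀ u ∈ L, HasGrowth u.1 u.2)
    (hx : ∀ l, l <+: L.map Prod.snd → x + (l.map (· + 1)).sum ≤ -1) :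
    ∃ C, 0 ≤ C ∧ ∀ n : ℕ,
      ((n : ℝ) + 1) ^ (x + 1) * nestedSum 1 (L.map Prod.fst) (n + 1) ≤ C * √((n : ℝ) + 1) := by
  have hx0 : x + 1 ≤ 0 := by
    have := hx [] (by simp)
    simp at this
    linarith
  induction L generalizing x with
  | nil =>
    refine ⟨1, zero_le_one, fun n => ?_⟩
    have h1 : (1 : ℝ) ≤ (n : ℝ) + 1 := by linarith [(Nat.cast_nonneg n : (0 : ℝ) ≤ n)]
    have h2 := zpow_le_one_of_nonpos₀ h1 hx0
    have h3 := Real.one_le_sqrt.2 h1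
    simp only [List.map_nil, nestedSum, mul_one, one_mul]
    linarith
  | cons u L ih =>
    obtain ⟨hu0, C, hC, hu⟩ := hL u (by simp)
    have hx' : ∀ l, l <+: L.map Prod.snd → (x + u.2 + 1) + (l.map (· + 1)).sum ≤ -1 := by
      intro l hl
      have := hx (u.2 :: l) (by simpa using hl)
      simp only [List.map_cons, List.sum_cons] at this
      linarith
    obtain ⟨C', hC', h'⟩ := ih (x + u.2 + 1) (fun v hv => hL v (by simp [hv])) hx' (by
      have := hx' [] (by simp)
      simp at this
      linarith)
    refine ⟨C * C' * 2, by positivity, fun n => ?_⟩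
    have hN : ∀ m, 0 ≤ nestedSum 1 (L.map Prod.fst) m := nestedSum_nonneg (by
      intro v hv
      obtain ⟨w, hw, rfl⟩ := List.mem_map.1 hv
      exact (hL w (by simp [hw])).1)
    have key : ∀ k ∈ Finset.range (n + 1),
        ((n : ℝ) + 1) ^ (x + 1) * (u.1 k * nestedSum 1 (L.map Prod.fst) (k + 1))
          ≤ C * C' * (√((k : ℝ) + 1))⁻¹ := by
      intro k hk
      have hk0 : (0 : ℝ) < (k : ℝ) + 1 := by positivity
      have hkn : (k : ℝ) + 1 ≤ (n : ℝ) + 1 := by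
        have : k ≤ n := by simpa [Nat.lt_succ_iff] using hk
        exact_mod_cast Nat.succ_le_succ this
      have e1 : ((n : ℝ) + 1) ^ (x + 1) ≤ ((k : ℝ) + 1) ^ (x + 1) := by
        obtain ⟨w, hw⟩ := Int.eq_ofNat_of_zero_le (neg_nonneg.2 hx0)
        have : x + 1 = -(w : ℤ) := by linarith
        rw [this, zpow_neg, zpow_neg, zpow_natCast, zpow_natCast]
        gcongr
      have e2 := h' k
      have e3 : ((k : ℝ) + 1) ^ (x + 1) * (((k : ℝ) + 1) ^ u.2)
          = ((k : ℝ) + 1)⁻¹ * ((k : ℝ) + 1) ^ (x + u.2 + 1 + 1) := by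
        rw [← zpow_add₀ hk0.ne', ← zpow_neg_one, ← zpow_add₀ hk0.ne']
        congr 1
        ring
      have e4 : ((k : ℝ) + 1)⁻¹ * √((k : ℝ) + 1) = (√((k : ℝ) + 1))⁻¹ := by
        have hs : (0 : ℝ) < √((k : ℝ) + 1) := Real.sqrt_pos.2 hk0
        have h2 : √((k : ℝ) + 1) * √((k : ℝ) + 1) = k + 1 := Real.mul_self_sqrt hk0.le
        rw [inv_mul_eq_iff_eq_mul₀ hk0.ne', eq_mul_inv_iff_mul_eq₀ hs.ne', h2]
      calc ((n : ℝ) + 1) ^ (x + 1) * (u.1 k * nestedSum 1 (L.map Prod.fst) (k + 1))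
          ≤ ((k : ℝ) + 1) ^ (x + 1) *
              ((C * ((k : ℝ) + 1) ^ u.2) * nestedSum 1 (L.map Prod.fst) (k + 1)) := by
            have := hN (k + 1)
            have := hu0 k
            have := hu k
            gcongr
        _ = C * ((k : ℝ) + 1)⁻¹ * (((k : ℝ) + 1) ^ (x + u.2 + 1 + 1) *
              nestedSum 1 (L.map Prod.fst) (k + 1)) := by
            linear_combination (C * nestedSum 1 (L.map Prod.fst) (k + 1)) * e3
        _ ≤ C * ((k : ℝ) + 1)⁻¹ * (C' * √((k : ℝ) + 1)) := by gcongr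
        _ = C * C' * (√((k : ℝ) + 1))⁻¹ := by rw [← e4]; ring
    rw [List.map_cons, nestedSum, Finset.mul_sum]
    refine (Finset.sum_le_sum key).trans ?_
    rw [← Finset.mul_sum, mul_assoc (C * C')]
    have := sum_range_inv_sqrt_le (n + 1)
    push_cast at this
    gcongr

theorem summable_inv_sq_mul_sqrt :
    Summable fun k : ℕ => (((k : ℝ) + 1) ^ 2)⁻¹ * √((k : ℝ) + 1) := by
  have h := (summable_nat_add_iff 1).2
    (Real.summable_nat_rpow_inv.2 (by norm_num : (1 : ℝ) < 3 / 2))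
  refine h.congr fun k => ?_
  have hk : (0 : ℝ) < (k : ℝ) + 1 := by positivity
  push_cast
  rw [Real.sqrt_eq_rpow, ← Real.rpow_natCast, ← Real.rpow_neg hk.le, ← Real.rpow_neg hk.le,
    ← Real.rpow_add hk]
  norm_num

/-- Under the convergence condition the nested sums are bounded. -/
theorem nestedSum_le_of_growth (L : List ((ℕ → ℝ) × ℤ)) (hL : ∀ u ∈ L, HasGrowth u.1 u.2)
    (hd : ∀ l, l <+: L.map Prod.snd → l ≠ [] → (l.map (· + 1)).sum ≤ -1) :
    ∃ b, ∀ n, nestedSum 1 (L.map Prod.fst) n ≤ b := by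
  cases L with
  | nil => exact ⟨1, fun n => by simp [nestedSum]⟩
  | cons u L =>
    obtain ⟨hu0, C, hC, hu⟩ := hL u (by simp)
    obtain ⟨C', hC', h'⟩ := zpow_mul_nestedSum_le L (u.2 + 1) (fun v hv => hL v (by simp [hv]))
      (fun l hl => by simpa using hd (u.2 :: l) (by simpa using hl) (by simp))
    have hN : ∀ m, 0 ≤ nestedSum 1 (L.map Prod.fst) m := nestedSum_nonneg (by
      intro v hv
      obtain ⟨w, hw, rfl⟩ := List.mem_map.1 hv
      exact (hL w (by simp [hw])).1)
    refine ⟨C * C' * ∑' k : ℕ, (((k : ℝ) + 1) ^ 2)⁻¹ * √((k : ℝ) + 1), fun n => ?_⟩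
    rw [List.map_cons, nestedSum]
    refine le_trans (Finset.sum_le_sum (g := fun k : ℕ =>
      C * C' * ((((k : ℝ) + 1) ^ 2)⁻¹ * √((k : ℝ) + 1))) fun k _ => ?_) ?_
    · have hk0 : (0 : ℝ) < (k : ℝ) + 1 := by positivity
      have e3 : ((k : ℝ) + 1) ^ u.2
          = (((k : ℝ) + 1) ^ 2)⁻¹ * ((k : ℝ) + 1) ^ (u.2 + 1 + 1) := by
        rw [← zpow_natCast, ← zpow_neg, ← zpow_add₀ hk0.ne']
        congr 1
        push_cast
        ring
      calc u.1 k * nestedSum 1 (L.map Prod.fst) (k + 1)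
          ≤ (C * ((k : ℝ) + 1) ^ u.2) * nestedSum 1 (L.map Prod.fst) (k + 1) := by
            have := hN (k + 1)
            have := hu k
            gcongr
        _ = C * (((k : ℝ) + 1) ^ 2)⁻¹ * (((k : ℝ) + 1) ^ (u.2 + 1 + 1) *
              nestedSum 1 (L.map Prod.fst) (k + 1)) := by rw [e3]; ring
        _ ≤ C * (((k : ℝ) + 1) ^ 2)⁻¹ * (C' * √((k : ℝ) + 1)) := by
            have := h' k
            gcongr
        _ = _ := by ring
    · rw [← Finset.mul_sum]
      have := summable_inv_sq_mul_sqrt.sum_le_tsum (Finset.range n) (fun k _ => by positivity)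
      gcongr

/-- The function `x ^ a / ∏ (x + j)` of `x = k + 1`. -/
noncomputable def ratGen (a : ℕ) (M : Multiset ℕ) : ℕ → ℂ :=
  fun k => ((k : ℂ) + 1) ^ a * (M.map fun j : ℕ => ((k : ℂ) + 1 + j)⁻¹).prod

/-- Rational functions of degree at most `d` in `x = k + 1` whose poles are nonpositive integers. -/
noncomputable def ratSpan (K : Type*) [Field K] [Algebra K ℂ] (d : ℤ) : Submodule K (ℕ → ℂ) :=
  Submodule.span K {f | ∃ (a : ℕ) (M : Multiset ℕ), (a : ℤ) ≤ d + M.card ∧ f = ratGen a M}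

section RatSpan

variable {K : Type*} [Field K] [Algebra K ℂ]

theorem algebra_smul_apply (c : K) (f : ℕ → ℂ) (k : ℕ) :
    (c • f) k = algebraMap K ℂ c * f k := by
  rw [Pi.smul_apply, Algebra.smul_def]

theorem ratGen_mem {d : ℤ} {a : ℕ} {M : Multiset ℕ} (h : (a : ℤ) ≤ d + M.card) :
    ratGen a M ∈ ratSpan K d :=
  Submodule.subset_span ⟨a, M, h, rfl⟩

theorem ratSpan_mono {d e : ℤ} (h : d ≤ e) : ratSpan K d ≤ ratSpan K e := by
  refine Submodule.span_mono ?_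
  rintro f ⟨a, M, ha, rfl⟩
  exact ⟨a, M, by linarith, rfl⟩

theorem mul_mem_ratSpan {d e : ℤ} {f g : ℕ → ℂ} (hf : f ∈ ratSpan K d) (hg : g ∈ ratSpan K e) :
    f * g ∈ ratSpan K (d + e) := by
  have h := Submodule.mul_mem_mul hf hg
  rw [ratSpan, ratSpan, Submodule.span_mul_span] at h
  refine Submodule.span_mono ?_ h
  rintro _ ⟨_, ⟨a, M, ha, rfl⟩, _, ⟨b, N, hb, rfl⟩, rfl⟩
  refine ⟨a + b, M + N, by push_cast [Multiset.card_add]; linarith, ?_⟩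
  funext k
  simp only [ratGen, Pi.mul_apply, Multiset.map_add, Multiset.prod_add, pow_add]
  ring

theorem shift_mem_ratSpan {d : ℤ} {f : ℕ → ℂ} (hf : f ∈ ratSpan K d) :
    (fun k => f (k + 1)) ∈ ratSpan K d := by
  have : ratSpan K d ≤ (ratSpan K d).comap (LinearMap.funLeft K ℂ (· + 1)) := by
    refine Submodule.span_le.2 ?_
    rintro _ ⟨a, M, ha, rfl⟩
    have h : LinearMap.funLeft K ℂ (· + 1) (ratGen a M)
        = ∑ i ∈ Finset.range (a + 1), (a.choose i : K) • ratGen i (M.map (· + 1)) := by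
      funext k
      simp only [LinearMap.funLeft_apply, Finset.sum_apply, algebra_smul_apply,
        ratGen, Multiset.map_map, Function.comp_apply, map_natCast]
      push_cast
      rw [add_pow, Finset.sum_mul]
      refine Finset.sum_congr rfl fun i _ => ?_
      have : (M.map fun j : ℕ => ((k : ℂ) + 1 + 1 + j)⁻¹)
          = (M.map fun j : ℕ => ((k : ℂ) + 1 + (j + 1))⁻¹) := by
        refine Multiset.map_congr rfl fun j _ => ?_
        ring
      rw [this]
      ring
    rw [SetLike.mem_coe, Submodule.mem_comap, h]
    refine Submodule.sum_mem _ fun i hi => Submodule.smul_mem _ _ (ratGen_mem ?_)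
    have : i ≤ a := Nat.lt_succ_iff.1 (Finset.mem_range.1 hi)
    rw [Multiset.card_map]
    have : (i : ℤ) ≤ a := by exact_mod_cast this
    linarith
  exact this hf

theorem exists_algebraMap_eq_of_mem_ratSpan {d : ℤ} {f : ℕ → ℂ} (hf : f ∈ ratSpan K d) (k : ℕ) :
    ∃ c : K, algebraMap K ℂ c = f k := by
  induction hf using Submodule.span_induction with
  | mem f h =>
    obtain ⟨a, M, -, rfl⟩ := h
    refine ⟨((k : K) + 1) ^ a * (M.map fun j : ℕ => ((k : K) + 1 + j)⁻¹).prod, ?_⟩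
    simp [ratGen, map_multiset_prod, Multiset.map_map]
  | zero => exact ⟨0, by simp⟩
  | add f g _ _ hf hg =>
    obtain ⟨a, ha⟩ := hf
    obtain ⟨b, hb⟩ := hg
    exact ⟨a + b, by simp [ha, hb]⟩
  | smul c f _ hf =>
    obtain ⟨a, ha⟩ := hf
    exact ⟨c * a, by simp [ha, Algebra.smul_def]⟩

theorem hasGrowth_of_mem_ratSpan {d : ℤ} {f : ℕ → ℂ} (hf : f ∈ ratSpan K d) :
    HasGrowth (fun k => ‖f k‖) d := by
  refine ⟨fun k => norm_nonneg _, ?_⟩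
  induction hf using Submodule.span_induction with
  | mem f h =>
    obtain ⟨a, M, h, rfl⟩ := h
    refine ⟨1, zero_le_one, fun k => ?_⟩
    have hk : (1 : ℝ) ≤ (k : ℝ) + 1 := by linarith [(Nat.cast_nonneg k : (0 : ℝ) ≤ k)]
    have hk0 : (k : ℝ) + 1 ≠ 0 := by positivity
    have h1 : ‖((k : ℂ) + 1)‖ = (k : ℝ) + 1 := by
      exact_mod_cast Complex.norm_natCast (k + 1)
    have h2 : ‖(M.map fun j : ℕ => ((k : ℂ) + 1 + j)⁻¹).prod‖
        ≤ ((k : ℝ) + 1) ^ (-(M.card : ℤ)) := by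
      clear h
      induction M using Multiset.induction with
      | empty => simp
      | cons j M ih =>
        rw [Multiset.map_cons, Multiset.prod_cons, norm_mul, Multiset.card_cons]
        push_cast
        rw [neg_add, zpow_add₀ hk0, zpow_neg_one]
        have : ‖((k : ℂ) + 1 + j)⁻¹‖ ≤ ((k : ℝ) + 1)⁻¹ := by
          rw [norm_inv]
          have : ‖((k : ℂ) + 1 + j)‖ = (k : ℝ) + 1 + j := by
            exact_mod_cast Complex.norm_natCast (k + 1 + j)
          rw [this]
          refine inv_anti₀ (by positivity) ?_
          linarith [(Nat.cast_nonneg j : (0 : ℝ) ≤ j)]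
        rw [mul_comm (((k : ℝ) + 1) ^ _)]
        exact mul_le_mul this ih (norm_nonneg _) (by positivity)
    rw [one_mul]
    calc ‖ratGen a M k‖ ≤ ((k : ℝ) + 1) ^ a * ((k : ℝ) + 1) ^ (-(M.card : ℤ)) := by
          rw [ratGen, norm_mul, norm_pow, h1]
          gcongr
      _ = ((k : ℝ) + 1) ^ ((a : ℤ) - M.card) := by
          rw [sub_eq_add_neg, zpow_add₀ hk0, zpow_natCast]
      _ ≤ ((k : ℝ) + 1) ^ d := zpow_le_zpow_right₀ hk (by linarith)
  | zero => exact ⟨0, le_rfl, by simp⟩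
  | add f g _ _ hf hg =>
    obtain ⟨a, ha, hf⟩ := hf
    obtain ⟨b, hb, hg⟩ := hg
    refine ⟨a + b, add_nonneg ha hb, fun k => (norm_add_le _ _).trans ?_⟩
    rw [add_mul]
    exact add_le_add (hf k) (hg k)
  | smul c f _ hf =>
    obtain ⟨a, ha, hf⟩ := hf
    refine ⟨‖algebraMap K ℂ c‖ * a, by positivity, fun k => ?_⟩
    simp only [algebra_smul_apply, norm_mul, mul_assoc]
    exact mul_le_mul_of_nonneg_left (hf k) (norm_nonneg _)

/-- The function `1 / (x + j) ^ s` of `x = k + 1`. -/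
noncomputable def pole (j s : ℕ) : ℕ → ℂ := fun k => (((k : ℂ) + 1 + j) ^ s)⁻¹

theorem pole_mem_ratSpan (j s : ℕ) : pole j s ∈ ratSpan K (-(s : ℤ)) := by
  have : pole j s = ratGen 0 (Multiset.replicate s j) := by
    funext k
    simp [pole, ratGen]
  rw [this]
  exact ratGen_mem (by simp)

theorem pow_mem_ratSpan (t : ℕ) : (fun k : ℕ => ((k : ℂ) + 1) ^ t) ∈ ratSpan K t := by
  have : (fun k : ℕ => ((k : ℂ) + 1) ^ t) = ratGen t 0 := by
    funext k
    simp [ratGen]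
  rw [this]
  exact ratGen_mem (by simp)

variable (K) in
/-- The forward difference operator. -/
def diffOp : (ℕ → ℂ) →ₗ[K] (ℕ → ℂ) where
  toFun g k := g (k + 1) - g k
  map_add' f g := by funext k; simp only [Pi.add_apply]; ring
  map_smul' c f := by funext k; simp [smul_sub]

theorem diffOp_apply (g : ℕ → ℂ) (k : ℕ) : diffOp K g k = g (k + 1) - g k := rfl

theorem pow_mem_map_diffOp [CharZero K] (t : ℕ) :
    (fun k : ℕ => ((k : ℂ) + 1) ^ t) ∈ (ratSpan K (t + 1)).map (diffOp K) := by
  induction t using Nat.strong_induction_on with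
  | _ t ih =>
    have h1 : (fun k : ℕ => ((k : ℂ) + 1) ^ t) = ((t : K) + 1)⁻¹ •
        (diffOp K (fun k : ℕ => ((k : ℂ) + 1) ^ (t + 1)) -
          ∑ i ∈ Finset.range t, ((t + 1).choose i : K) • fun k : ℕ => ((k : ℂ) + 1) ^ i) := by
      have ht : (t : K) + 1 ≠ 0 := Nat.cast_add_one_ne_zero t
      rw [eq_inv_smul_iff₀ ht]
      funext k
      simp only [algebra_smul_apply, Pi.sub_apply, diffOp_apply, Finset.sum_apply,
        map_natCast, map_add, map_one]
      push_cast
      rw [add_pow ((k : ℂ) + 1) 1 (t + 1), Finset.sum_range_succ, Finset.sum_range_succ]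
      simp only [one_pow, mul_one, Nat.choose_self, Nat.choose_succ_self_right]
      push_cast
      have : ∀ i, ((k : ℂ) + 1) ^ i * ((t + 1).choose i : ℂ)
          = ((t + 1).choose i : ℂ) * ((k : ℂ) + 1) ^ i := fun i => mul_comm _ _
      simp only [this]
      ring
    rw [h1]
    refine Submodule.smul_mem _ _ (Submodule.sub_mem _ (Submodule.mem_map_of_mem ?_)
      (Submodule.sum_mem _ fun i hi => Submodule.smul_mem _ _ ?_))
    · exact_mod_cast pow_mem_ratSpan (K := K) (t + 1)
    · have hi := Finset.mem_range.1 hi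
      exact Submodule.map_mono (ratSpan_mono (by omega)) (ih i hi)

theorem aeval_mem_map_diffOp [CharZero K] (q : Polynomial K) (D : ℕ) (hq : q.degree < D)
    {γ : ℤ} (hγ : (D : ℤ) ≤ γ ∨ D = 0) :
    (fun k : ℕ => Polynomial.aeval ((k : ℂ) + 1) q) ∈ (ratSpan K γ).map (diffOp K) := by
  have : (fun k : ℕ => Polynomial.aeval ((k : ℂ) + 1) q)
      = ∑ i ∈ Finset.range D, q.coeff i • fun k : ℕ => ((k : ℂ) + 1) ^ i := by
    funext k
    rw [Polynomial.aeval_def, Polynomial.eval₂_eq_sum,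
      Polynomial.sum_eq_of_subset (s := Finset.range D)]
    · simp [Algebra.smul_def]
    · simp
    · intro i hi
      rw [Finset.mem_range]
      exact_mod_cast lt_of_le_of_lt (Polynomial.le_degree_of_mem_supp i hi) hq
  rw [this]
  refine Submodule.sum_mem _ fun i hi => Submodule.smul_mem _ _ ?_
  have hi := Finset.mem_range.1 hi
  exact Submodule.map_mono (ratSpan_mono (by omega)) (pow_mem_map_diffOp i)

theorem pole_sub_pole_mem (j s : ℕ) {γ : ℤ} (hγ : -(s : ℤ) ≤ γ) :
    pole j s - pole 0 s ∈ (ratSpan K γ).map (diffOp K) := by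
  refine ⟨∑ i ∈ Finset.range j, pole i s,
    Submodule.sum_mem _ fun i _ => ratSpan_mono hγ (pole_mem_ratSpan i s), ?_⟩
  funext k
  rw [diffOp_apply, Finset.sum_apply, Finset.sum_apply, ← Finset.sum_sub_distrib]
  have : ∀ i, pole i s (k + 1) - pole i s k = pole (i + 1) s k - pole i s k := by
    intro i
    simp only [pole]
    push_cast
    ring_nf
  simp only [this]
  exact Finset.sum_range_sub (fun i => pole i s k) j

end RatSpan

section PartialFractions

open Polynomial

variable {K : Type*} [Field K] [Algebra K ℂ]

theorem exists_partialFraction [CharZero K] (M : Multiset ℕ) :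
    ∀ D, M.card ≤ D → ∀ N : K[X], N.degree < D → ∃ q : K[X], q.degree < (D - M.card : ℕ) ∧
      ∃ c : ℕ × ℕ →₀ K,
        (∀ x ∈ c.support, x.1 ∈ M ∧ 1 ≤ x.2 ∧ x.2 ≤ M.count x.1) ∧
        ∀ z : ℂ, (∀ j ∈ M, z + (j : ℂ) ≠ 0) →
          aeval z N * (M.map fun j : ℕ => (z + (j : ℂ))⁻¹).prod
            = aeval z q + c.sum fun x a => algebraMap K ℂ a * ((z + (x.1 : ℂ)) ^ x.2)⁻¹ := by
  induction M using Multiset.induction with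
  | empty =>
    intro D _ N hN
    exact ⟨N, by simpa using hN, 0, by simp, by simp⟩
  | cons a M ih =>
    intro D hD N hN
    rw [Multiset.card_cons] at hD
    obtain ⟨D, rfl⟩ : ∃ D', D = D' + 1 := ⟨D - 1, by omega⟩
    set F := M.filter (a ≠ ·) with hF
    have hM : M = Multiset.replicate (M.count a) a + F := by
      conv_lhs => rw [← Multiset.filter_add_not (a = ·) M]
      rw [Multiset.filter_eq]
    set E : K[X] := (F.map fun j : ℕ => X + C (j : K)).prod with hE
    have hEa : E.eval (-(a : K)) ≠ 0 := by
      rw [hE, eval_multiset_prod, Multiset.map_map]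
      refine Multiset.prod_ne_zero fun h => ?_
      obtain ⟨j, hj, h0⟩ := Multiset.mem_map.1 h
      simp only [Function.comp_apply, eval_add, eval_X, eval_C] at h0
      refine (Multiset.mem_filter.1 hj).2 ?_
      have : (a : K) = j := by linear_combination -h0
      exact_mod_cast this
    have hEdeg : E.degree < (D + 1 : ℕ) := by
      have h1 : E.natDegree ≤ F.card := by
        refine (natDegree_multiset_prod_le _).trans ?_
        rw [Multiset.map_map]
        refine (Multiset.sum_le_card_nsmul _ 1 ?_).trans (by simp)
        intro x hx
        obtain ⟨j, -, rfl⟩ := Multiset.mem_map.1 hx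
        exact (natDegree_X_add_C _).le
      have h2 : F.card ≤ M.card := Multiset.card_le_card (Multiset.filter_le _ _)
      exact lt_of_le_of_lt degree_le_natDegree (by exact_mod_cast (by omega))
    set c₀ : K := N.eval (-(a : K)) / E.eval (-(a : K)) with hc₀
    obtain ⟨N₁, hN₁⟩ : X - C (-(a : K)) ∣ N - C c₀ * E := by
      rw [dvd_iff_isRoot, IsRoot.def, eval_sub, eval_mul, eval_C, hc₀, div_mul_cancel₀ _ hEa,
        sub_self]
    have hN₁deg : N₁.degree < (D : ℕ) := by
      by_cases h0 : N₁ = 0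
      · rw [h0, degree_zero]
        exact WithBot.bot_lt_coe _
      have h1 : (N - C c₀ * E).degree < (D + 1 : ℕ) := by
        refine (degree_sub_le _ _).trans_lt (max_lt hN ?_)
        refine lt_of_le_of_lt ?_ hEdeg
        rw [← smul_eq_C_mul]
        exact degree_smul_le _ _
      rw [hN₁, degree_mul, degree_X_sub_C, degree_eq_natDegree h0] at h1
      rw [degree_eq_natDegree h0]
      have : 1 + N₁.natDegree < D + 1 := by exact_mod_cast h1
      exact_mod_cast (by omega)
    obtain ⟨q, hq, c, hc, hz⟩ := ih D (by omega) N₁ hN₁deg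
    refine ⟨q, ?_, c + Finsupp.single (a, M.count a + 1) c₀, ?_, ?_⟩
    · rw [Multiset.card_cons, Nat.add_sub_add_right]
      exact hq
    · intro x hx
      rcases Finset.mem_union.1 (Finsupp.support_add hx) with hx | hx
      · obtain ⟨h1, h2, h3⟩ := hc x hx
        exact ⟨Multiset.mem_cons_of_mem h1, h2, h3.trans (Multiset.count_le_count_cons _ _ _)⟩
      · have := Finset.mem_singleton.1 (Finsupp.support_single_subset hx)
        subst this
        simp
    · intro z hzM
      have hza : z + (a : ℂ) ≠ 0 := hzM a (by simp)
      rw [Finsupp.sum_add_index' (by simp) (by intros; simp [add_mul]),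
        Finsupp.sum_single_index (by simp), ← add_assoc,
        ← hz z (fun j hj => hzM j (Multiset.mem_cons_of_mem hj))]
      have hN₂ : aeval z N = (z + a) * aeval z N₁ + algebraMap K ℂ c₀ * aeval z E := by
        have := congrArg (aeval z) hN₁
        simp only [map_sub, map_mul, aeval_X, aeval_C, map_neg, map_natCast] at this
        linear_combination this
      have hE₂ : aeval z E * (F.map fun j : ℕ => (z + (j : ℂ))⁻¹).prod = 1 := by
        rw [hE, map_multiset_prod, Multiset.map_map, ← Multiset.prod_map_mul]
        refine Multiset.prod_eq_one fun x hx => ?_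
        obtain ⟨j, hj, rfl⟩ := Multiset.mem_map.1 hx
        have : z + (j : ℂ) ≠ 0 :=
          hzM j (Multiset.mem_cons_of_mem (Multiset.mem_of_mem_filter hj))
        simp [this]
      have hM₂ : (M.map fun j : ℕ => (z + (j : ℂ))⁻¹).prod
          = ((z + (a : ℂ))⁻¹) ^ M.count a * (F.map fun j : ℕ => (z + (j : ℂ))⁻¹).prod := by
        conv_lhs => rw [hM]
        simp
      rw [Multiset.map_cons, Multiset.prod_cons, hN₂, pow_succ, mul_inv, ← inv_pow]
      have h4 : (z + (a : ℂ)) * (z + (a : ℂ))⁻¹ = 1 := mul_inv_cancel₀ hza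
      linear_combination (aeval z N₁ * (M.map fun j : ℕ => (z + (j : ℂ))⁻¹).prod) * h4
        + algebraMap K ℂ c₀ * aeval z E * (z + (a : ℂ))⁻¹ * hM₂
        + algebraMap K ℂ c₀ * (z + (a : ℂ))⁻¹ * ((z + (a : ℂ))⁻¹) ^ M.count a * hE₂

end PartialFractions

section Decomposition

variable {K : Type*} [Field K] [Algebra K ℂ]

/-- Combinations of powers `x ^ (-s)` with `s ∈ B`, up to differences of rational functions. -/
noncomputable def decSpan (K : Type*) [Field K] [Algebra K ℂ] (B : Set ℕ) (γ : ℤ) :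
    Submodule K (ℕ → ℂ) :=
  Submodule.span K (pole 0 '' B) ⊔ (ratSpan K γ).map (diffOp K)

theorem pole_mem_decSpan {B : Set ℕ} {γ : ℤ} (hγ : -1 ≤ γ) (j : ℕ) {s : ℕ} (hs : s ∈ B)
    (h1 : 1 ≤ s) : pole j s ∈ decSpan K B γ := by
  rw [← add_sub_cancel (pole 0 s) (pole j s)]
  exact Submodule.add_mem_sup (Submodule.subset_span ⟨s, hs, rfl⟩)
    (pole_sub_pole_mem j s (by omega))

theorem pole_sub_pole_mem_decSpan {B : Set ℕ} {γ : ℤ} (hγ : -1 ≤ γ) (i j : ℕ) {s : ℕ}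
    (h1 : 1 ≤ s) : pole i s - pole j s ∈ decSpan K B γ := by
  rw [← sub_sub_sub_cancel_right (pole i s) (pole j s) (pole 0 s)]
  refine Submodule.mem_sup_right (Submodule.sub_mem _ ?_ ?_) <;>
    exact pole_sub_pole_mem _ s (by omega)

theorem ratSpan_le_decSpan [CharZero K] (d : ℤ) :
    ratSpan K d ≤ decSpan K {s | 1 ≤ s} (max (d + 1) (-1)) := by
  refine Submodule.span_le.2 ?_
  rintro _ ⟨a, M, h, rfl⟩
  obtain ⟨q, hq, c, hc, hz⟩ := exists_partialFraction (K := K) M (max (a + 1) M.card)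
    (le_max_right _ _) (Polynomial.X ^ a) (by
      rw [Polynomial.degree_X_pow]
      exact_mod_cast (by omega))
  have : ratGen a M = (fun k : ℕ => Polynomial.aeval ((k : ℂ) + 1) q)
      + c.sum fun x b => b • pole x.1 x.2 := by
    funext k
    have h1 := hz ((k : ℂ) + 1) (fun j _ => by
      have : ((k + 1 + j : ℕ) : ℂ) ≠ 0 := Nat.cast_ne_zero.2 (by omega)
      exact_mod_cast this)
    rw [map_pow, Polynomial.aeval_X] at h1
    rw [ratGen, h1, Pi.add_apply, Finsupp.sum, Finsupp.sum, Finset.sum_apply]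
    simp only [algebra_smul_apply, pole]
  rw [this]
  refine Submodule.add_mem _ (Submodule.mem_sup_right (aeval_mem_map_diffOp q _ hq (by omega)))
    (Submodule.sum_mem _ fun x hx => Submodule.smul_mem _ _ ?_)
  exact pole_mem_decSpan (by omega) _ (hc x hx).2.1 (hc x hx).2.1

/-- Sequences with bounded partial sums. -/
theorem exists_norm_sum_le_of_mem_ratSpan {f : ℕ → ℂ} (hf : f ∈ ratSpan K (-2)) :
    ∃ b, ∀ n, ‖∑ k ∈ Finset.range n, f k‖ ≤ b := by
  obtain ⟨b, hb⟩ := nestedSum_le_of_growth [((fun k => ‖f k‖), -2)]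
    (by simpa using hasGrowth_of_mem_ratSpan hf) (by
      intro l hl hl0
      rcases List.prefix_cons_iff.1 hl with h | ⟨t, rfl, ht⟩
      · exact absurd h hl0
      · have : t = [] := by simpa using ht
        subst this
        simp)
  refine ⟨b, fun n => (norm_sum_le _ _).trans ?_⟩
  simpa [nestedSum] using hb n

theorem not_exists_norm_sum_pole_le :
    ¬ ∃ b, ∀ n, ‖∑ k ∈ Finset.range n, pole 0 1 k‖ ≤ b := by
  rintro ⟨b, hb⟩
  obtain ⟨n, hn⟩ := (Real.tendsto_sum_range_one_div_nat_succ_atTop.eventually_gt_atTop b).exists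
  refine absurd (hb n) (not_le.2 (hn.trans_le ?_))
  have : ∑ k ∈ Finset.range n, pole 0 1 k
      = ((∑ k ∈ Finset.range n, 1 / ((k : ℝ) + 1) : ℝ) : ℂ) := by
    push_cast
    simp [pole]
  rw [this, Complex.norm_real]
  exact le_abs_self _

theorem mem_decSpan_diff_one {B : Set ℕ} {d : ℤ} (hB : ∀ s ∈ B, 1 ≤ s) (hd : d ≤ -2)
    {f : ℕ → ℂ} (hf : f ∈ ratSpan K d) (hfB : f ∈ decSpan K B (-1)) :
    f ∈ decSpan K (B \ {1}) (-1) := by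
  obtain ⟨u, hu, _, ⟨g, hg, rfl⟩, rfl⟩ := Submodule.mem_sup.1 hfB
  have hu' : u ∈ Submodule.span K (insert (pole 0 1) (pole 0 '' (B \ {1}))) := by
    refine Submodule.span_mono ?_ hu
    rw [← Set.image_insert_eq, Set.insert_sdiff_singleton]
    exact Set.image_mono (Set.subset_insert _ _)
  obtain ⟨c, w, hw, rfl⟩ := Submodule.mem_span_insert.1 hu'
  refine Submodule.add_mem_sup ?_ (Submodule.mem_map_of_mem hg)
  by_cases hc : c = 0
  · simpa [hc] using hw
  exfalso
  refine not_exists_norm_sum_pole_le ?_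
  have hw2 : w ∈ ratSpan K (-2) := by
    refine Submodule.span_le.2 ?_ hw
    rintro _ ⟨s, ⟨hs, hs1⟩, rfl⟩
    have := hB s hs
    have : s ≠ 1 := hs1
    exact ratSpan_mono (by omega) (pole_mem_ratSpan 0 s)
  have h1 := Submodule.smul_mem _ c⁻¹ (Submodule.sub_mem _ (ratSpan_mono hd hf) hw2)
  obtain ⟨b₁, hb₁⟩ := exists_norm_sum_le_of_mem_ratSpan h1
  obtain ⟨-, C, hC, hgC⟩ := hasGrowth_of_mem_ratSpan (Submodule.smul_mem _ c⁻¹ hg)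
  have hgC' : ∀ k, ‖(c⁻¹ • g) k‖ ≤ C := by
    intro k
    refine (hgC k).trans ?_
    rw [zpow_neg_one]
    refine mul_le_of_le_one_right hC (inv_le_one_of_one_le₀ ?_)
    linarith [(Nat.cast_nonneg k : (0 : ℝ) ≤ k)]
  refine ⟨b₁ + (C + C), fun n => ?_⟩
  have : ∑ k ∈ Finset.range n, pole 0 1 k
      = ∑ k ∈ Finset.range n, (c⁻¹ • (c • pole 0 1 + w + diffOp K g - w)) k
        - ((c⁻¹ • g) n - (c⁻¹ • g) 0) := by
    rw [← Finset.sum_range_sub, ← Finset.sum_sub_distrib]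
    refine Finset.sum_congr rfl fun k _ => ?_
    have hc' : algebraMap K ℂ c⁻¹ * algebraMap K ℂ c = 1 := by
      rw [← map_mul, inv_mul_cancel₀ hc, map_one]
    simp only [algebra_smul_apply, Pi.add_apply, Pi.sub_apply, diffOp_apply]
    linear_combination (-pole 0 1 k) * hc'
  rw [this]
  refine (norm_sub_le _ _).trans (add_le_add (hb₁ n) ((norm_sub_le _ _).trans ?_))
  exact add_le_add (hgC' n) (hgC' 0)

/-- The summand `(x + r + n / 2) ^ m / (x + r)_{n + 1} ^ A` of `x = k + 1`. -/
noncomputable def wellPoised (m A n r : ℕ) : ℕ → ℂ := fun k =>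
  ((k : ℂ) + 1 + r + n / 2) ^ m /
    ((ascPochhammer ℂ (n + 1)).eval ((k : ℂ) + 1 + r)) ^ A

theorem ascPochhammer_eval_eq_prod (z : ℂ) (n : ℕ) :
    (ascPochhammer ℂ n).eval z = ∏ i ∈ Finset.range n, (z + i) := by
  induction n with
  | zero => simp
  | succ n ih => rw [ascPochhammer_succ_eval, ih, Finset.prod_range_succ]

theorem wellPoised_mem_decSpan [CharZero K] (m A n r : ℕ) :
    wellPoised m A n r ∈ ratSpan K ((m : ℤ) - (A * (n + 1) : ℕ)) ∧
    wellPoised m A n r ∈ decSpan K {s | 1 ≤ s ∧ s ≤ A ∧ Even (m + A * (n + 1) + s)}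
      (max ((m : ℤ) - (A * (n + 1) : ℕ) + 1) (-1)) := by
  classical
  set M : Multiset ℕ := A • (Multiset.range (n + 1)).map (r + ·) with hM
  have hcard : M.card = A * (n + 1) := by simp [hM]
  have hcount : ∀ x, M.count x ≤ A := by
    intro x
    rw [hM, Multiset.count_nsmul]
    refine mul_le_of_le_one_right (Nat.zero_le _) ?_
    exact Multiset.nodup_iff_count_le_one.1
      ((Multiset.nodup_range _).map (add_right_injective r)) x
  have hmem : ∀ x ∈ M, ∃ i ≤ n, x = r + i := by
    intro x hx
    obtain ⟨i, hi, rfl⟩ := Multiset.mem_map.1 (Multiset.mem_of_mem_nsmul hx)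
    exact ⟨i, Nat.lt_succ_iff.1 (Multiset.mem_range.1 hi), rfl⟩
  have hprod : ∀ z : ℂ, (M.map fun j : ℕ => (z + (j : ℂ))⁻¹).prod
      = ((∏ i ∈ Finset.range (n + 1), (z + r + i)) ^ A)⁻¹ := by
    intro z
    rw [hM, Multiset.map_nsmul, Multiset.prod_nsmul, Multiset.map_map, ← inv_pow,
      ← Finset.prod_inv_distrib]
    simp [Finset.prod, add_assoc]
  set N : Polynomial K := (Polynomial.X + Polynomial.C ((r : K) + n / 2)) ^ m with hN
  have hNz : ∀ z : ℂ, Polynomial.aeval z N = (z + r + n / 2) ^ m := by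
    intro z
    have h2 : algebraMap K ℂ 2 = 2 := map_ofNat _ 2
    simp [hN, h2, add_assoc]
  set G : ℂ → ℂ := fun z => Polynomial.aeval z N * (M.map fun j : ℕ => (z + (j : ℂ))⁻¹).prod
    with hG
  have hfG : ∀ k : ℕ, wellPoised m A n r k = G ((k : ℂ) + 1) := by
    intro k
    simp only [hG]
    rw [hNz, hprod, wellPoised, ascPochhammer_eval_eq_prod, div_eq_mul_inv]
  have hne : ∀ k j : ℕ, (k : ℂ) + 1 + j ≠ 0 := fun k j => by
    have : ((k + 1 + j : ℕ) : ℂ) ≠ 0 := Nat.cast_ne_zero.2 (by omega)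
    exact_mod_cast this
  have hNdeg : N.degree < (m + 1 : ℕ) := by
    rw [hN, Polynomial.degree_pow, Polynomial.degree_X_add_C]
    simp only [nsmul_eq_mul, mul_one]
    exact_mod_cast Nat.lt_succ_self m
  constructor
  · have : wellPoised m A n r = ∑ i ∈ Finset.range (m + 1), N.coeff i • ratGen i M := by
      funext k
      rw [hfG, Finset.sum_apply]
      simp only [hG, algebra_smul_apply, ratGen, ← mul_assoc]
      rw [← Finset.sum_mul]
      congr 1
      rw [Polynomial.aeval_def, Polynomial.eval₂_eq_sum,
        Polynomial.sum_eq_of_subset (s := Finset.range (m + 1))]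
      · simp
      · intro i hi
        rw [Finset.mem_range]
        exact_mod_cast lt_of_le_of_lt (Polynomial.le_degree_of_mem_supp i hi) hNdeg
    rw [this]
    refine Submodule.sum_mem _ fun i hi => Submodule.smul_mem _ _ (ratGen_mem ?_)
    have := Finset.mem_range.1 hi
    rw [hcard]
    omega
  · obtain ⟨q, hq, c, hc, hz⟩ := exists_partialFraction (K := K) M (max (m + 1) M.card)
      (le_max_right _ _) N (hNdeg.trans_le (by exact_mod_cast le_max_left _ _))
    set q' : Polynomial K := q.comp (-Polynomial.X - Polynomial.C (2 * (r : K) + n)) with hq'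
    have hq'deg : q'.degree < ((max (m + 1) M.card - M.card : ℕ) : WithBot ℕ) := by
      by_cases h0 : q = 0
      · rw [hq', h0, Polynomial.zero_comp, Polynomial.degree_zero]
        exact WithBot.bot_lt_coe _
      rw [Polynomial.degree_eq_natDegree h0] at hq
      refine lt_of_le_of_lt Polynomial.degree_le_natDegree (lt_of_le_of_lt ?_ hq)
      rw [hq', Polynomial.natDegree_comp]
      have : (-Polynomial.X - Polynomial.C (2 * (r : K) + n)).natDegree = 1 := by
        rw [Polynomial.natDegree_sub_C, Polynomial.natDegree_neg, Polynomial.natDegree_X]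
      rw [this, mul_one]
    set ε : K := (-1) ^ (m + A * (n + 1)) with hε
    have hε' : algebraMap K ℂ ε = (-1) ^ m * (-1) ^ (A * (n + 1)) := by
      rw [hε, map_pow, map_neg, map_one, pow_add]
    have hrefl : ∀ z : ℂ, algebraMap K ℂ ε * G (-z - (2 * r + n)) = G z := by
      intro z
      simp only [hG]
      rw [hNz, hNz, hprod, hprod]
      have h1 : -z - (2 * (r : ℂ) + n) + r + n / 2 = -(z + r + n / 2) := by ring
      have h2 : ∏ i ∈ Finset.range (n + 1), (-z - (2 * (r : ℂ) + n) + r + i)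
          = (-1) ^ (n + 1) * ∏ i ∈ Finset.range (n + 1), (z + r + i) := by
        rw [← Finset.prod_range_reflect (fun i : ℕ => z + r + (i : ℂ))]
        have : (-1 : ℂ) ^ (n + 1) = ∏ _i ∈ Finset.range (n + 1), (-1 : ℂ) := by simp
        rw [this, ← Finset.prod_mul_distrib]
        refine Finset.prod_congr rfl fun i hi => ?_
        have hi : i ≤ n := Nat.lt_succ_iff.1 (Finset.mem_range.1 hi)
        have : n + 1 - 1 - i = n - i := by omega
        rw [this, Nat.cast_sub hi]
        ring
      have h3 : (((-1 : ℂ) ^ (A * (n + 1)))⁻¹) = (-1) ^ (A * (n + 1)) := by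
        rw [← inv_pow, inv_neg_one]
      have h4 : ∀ t : ℕ, (-1 : ℂ) ^ t * (-1) ^ t = 1 := fun t => by
        rw [← mul_pow]; simp
      rw [h1, h2, neg_pow, mul_pow, ← pow_mul, mul_comm (n + 1) A, mul_inv, h3, hε']
      linear_combination ((z + r + n / 2) ^ m *
        ((∏ i ∈ Finset.range (n + 1), (z + r + i)) ^ A)⁻¹) * ((-1) ^ (A * (n + 1)) *
          (-1) ^ (A * (n + 1)) * h4 m + h4 (A * (n + 1)))
    have hdec : wellPoised m A n r
        = (2⁻¹ : K) • (fun k : ℕ => Polynomial.aeval ((k : ℂ) + 1) q)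
          + (2⁻¹ * ε) • (fun k : ℕ => Polynomial.aeval ((k : ℂ) + 1) q')
          + c.sum fun x b => (2⁻¹ * b) • (pole x.1 x.2
              + (ε * (-1) ^ x.2) • pole (2 * r + n - x.1) x.2) := by
      funext k
      have h1 := hz ((k : ℂ) + 1) (fun j _ => hne k j)
      have hx : ∀ x ∈ M, -((k : ℂ) + 1) - (2 * r + n) + x
          = -((k : ℂ) + 1 + ((2 * r + n - x : ℕ) : ℂ)) := by
        intro x hx
        obtain ⟨i, hi, rfl⟩ := hmem x hx
        rw [Nat.cast_sub (by omega)]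
        push_cast
        ring
      have h2 := hz (-((k : ℂ) + 1) - (2 * r + n)) (fun j hj => by
        rw [hx j hj]
        exact neg_ne_zero.2 (hne k _))
      have h3 : Polynomial.aeval (-((k : ℂ) + 1) - (2 * r + n)) q
          = Polynomial.aeval ((k : ℂ) + 1) q' := by
        rw [hq', Polynomial.aeval_comp]
        congr 1
        have h2 : algebraMap K ℂ 2 = 2 := map_ofNat _ 2
        simp [h2]
      have h4 : (c.sum fun x a => algebraMap K ℂ a *
          ((-((k : ℂ) + 1) - (2 * r + n) + (x.1 : ℂ)) ^ x.2)⁻¹)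
          = c.sum fun x a => algebraMap K ℂ a * ((-1) ^ x.2 * pole (2 * r + n - x.1) x.2 k) := by
        refine Finset.sum_congr rfl fun x hx' => ?_
        beta_reduce
        rw [hx x.1 (hc x hx').1, neg_pow, mul_inv, ← inv_pow, inv_neg_one, pole]
      rw [h3, h4] at h2
      have h5 := hrefl ((k : ℂ) + 1)
      have h9 : algebraMap K ℂ 2⁻¹ = 2⁻¹ := by rw [map_inv₀, map_ofNat]
      rw [hfG]
      have h6 : G ((k : ℂ) + 1) = 2⁻¹ * G ((k : ℂ) + 1)
          + 2⁻¹ * (algebraMap K ℂ ε * G (-((k : ℂ) + 1) - (2 * r + n))) := by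
        rw [h5]; ring
      rw [h6]
      simp only [hG]
      rw [h1, h2]
      have h8 : (c.sum fun x b => (2⁻¹ * b) • (pole x.1 x.2
          + (ε * (-1) ^ x.2) • pole (2 * r + n - x.1) x.2)) k
          = 2⁻¹ * (c.sum fun x a => algebraMap K ℂ a * (((k : ℂ) + 1 + x.1) ^ x.2)⁻¹)
            + 2⁻¹ * algebraMap K ℂ ε * (c.sum fun x a =>
              algebraMap K ℂ a * ((-1) ^ x.2 * pole (2 * r + n - x.1) x.2 k)) := by
        simp only [Finsupp.sum]
        rw [Finset.sum_apply, Finset.mul_sum, Finset.mul_sum, ← Finset.sum_add_distrib]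
        refine Finset.sum_congr rfl fun x _ => ?_
        simp only [algebra_smul_apply, Pi.add_apply, map_mul, h9, map_pow, map_neg, map_one]
        rw [pole]
        ring
      simp only [Pi.add_apply, algebra_smul_apply, map_mul, h9]
      rw [h8]
      ring
    rw [hdec]
    have hD : ((max (m + 1) M.card - M.card : ℕ) : ℤ)
        ≤ max ((m : ℤ) - (A * (n + 1) : ℕ) + 1) (-1) ∨ max (m + 1) M.card - M.card = 0 := by
      rw [hcard]
      omega
    refine Submodule.add_mem _ (Submodule.add_mem _ (Submodule.smul_mem _ _
      (Submodule.mem_sup_right (aeval_mem_map_diffOp q _ hq hD))) (Submodule.smul_mem _ _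
      (Submodule.mem_sup_right (aeval_mem_map_diffOp q' _ hq'deg hD))))
      (Submodule.sum_mem _ fun x hx => Submodule.smul_mem _ _ ?_)
    obtain ⟨hxM, hx1, hx2⟩ := hc x hx
    rw [hε, ← pow_add]
    rcases Nat.even_or_odd (m + A * (n + 1) + x.2) with he | ho
    · have hB : x.2 ∈ {s | 1 ≤ s ∧ s ≤ A ∧ Even (m + A * (n + 1) + s)} :=
        ⟨hx1, hx2.trans (hcount _), he⟩
      rw [he.neg_one_pow, one_smul]
      exact Submodule.add_mem _ (pole_mem_decSpan (le_max_right _ _) _ hB hx1)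
        (pole_mem_decSpan (le_max_right _ _) _ hB hx1)
    · rw [ho.neg_one_pow, neg_one_smul, ← sub_eq_add_neg]
      exact pole_sub_pole_mem_decSpan (le_max_right _ _) _ _ hx1

end Decomposition

section ZetaLimits

open Filter Topology

/-- The indices of convergent multiple zeta values. -/
def IsAdmissible (s : List ℕ) : Prop :=
  (∀ a ∈ s, 1 ≤ a) ∧ (s ≠ [] → 2 ≤ s.headI)

theorem monotone_nestedSum {δ : ℕ} {L : List (ℕ → ℝ)} (hL : ∀ u ∈ L, ∀ k, 0 ≤ u k) :
    Monotone (nestedSum δ L) := by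
  cases L with
  | nil => exact fun _ _ _ => le_rfl
  | cons u L =>
    intro m n hmn
    refine Finset.sum_le_sum_of_subset_of_nonneg (Finset.range_mono hmn) fun k _ _ => ?_
    exact mul_nonneg (hL u (by simp) k) (nestedSum_nonneg (fun v hv => hL v (by simp [hv])) _)

theorem nestedSum_zero_le_one {L : List (ℕ → ℝ)} (hL : ∀ u ∈ L, ∀ k, 0 ≤ u k) (n : ℕ) :
    nestedSum 0 L n ≤ nestedSum 1 L n := by
  induction L generalizing n with
  | nil => exact le_rfl
  | cons u L ih =>
    have hL' : ∀ v ∈ L, ∀ k, 0 ≤ v k := fun v hv => hL v (by simp [hv])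
    refine Finset.sum_le_sum fun k _ => mul_le_mul_of_nonneg_left ?_ (hL u (by simp) k)
    exact (ih hL' _).trans (monotone_nestedSum hL' (by omega))

theorem sum_map_neg_add_one_le {s : List ℕ} (hs : ∀ a ∈ s, 1 ≤ a) :
    ((s.map fun a : ℕ => -(a : ℤ)).map (· + 1)).sum ≤ 0 := by
  induction s with
  | nil => simp
  | cons a s ih =>
    have h1 := ih fun b hb => hs b (by simp [hb])
    have h2 := hs a (by simp)
    simp only [List.map_cons, List.sum_cons]
    omega

theorem hasGrowth_pole (s : ℕ) : HasGrowth (fun k => ‖pole 0 s k‖) (-(s : ℤ)) :=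
  hasGrowth_of_mem_ratSpan (K := ℂ) (pole_mem_ratSpan 0 s)

theorem exists_nestedSum_poles_le {s : List ℕ} (hs : IsAdmissible s) :
    ∃ b, ∀ n, nestedSum 1 ((s.map (pole 0)).map fun f k => ‖f k‖) n ≤ b := by
  have := nestedSum_le_of_growth (s.map fun a => (fun k => ‖pole 0 a k‖, -(a : ℤ))) (by
    intro u hu
    obtain ⟨a, -, rfl⟩ := List.mem_map.1 hu
    exact hasGrowth_pole a) (by
    intro l hl hne
    rw [List.map_map] at hl
    obtain ⟨t, ht, rfl⟩ := List.prefix_map_iff.1 hl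
    obtain ⟨w, rfl⟩ := ht
    cases t with
    | nil => simp at hne
    | cons a t =>
      have h1 := sum_map_neg_add_one_le (s := t) fun b hb => hs.1 b (by simp [hb])
      have h2 : 2 ≤ a := hs.2 (by simp)
      simp only [List.map_cons, List.sum_cons, Function.comp_def] at h1 ⊢
      omega)
  simpa [List.map_map, Function.comp_def] using this

theorem tendsto_nestedSum_zero_poles {s : List ℕ} (hs : IsAdmissible s) :
    Tendsto (nestedSum 0 (s.map (pole 0))) atTop (𝓝 (mzv s : ℂ)) := by
  have hofFn : s.map (pole 0) = List.ofFn fun i => pole 0 (s.get i) := by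
    conv_lhs => rw [← List.ofFn_get s, List.map_ofFn]
    rfl
  obtain ⟨b, hb⟩ := exists_nestedSum_poles_le hs
  have h := (tendsto_nestedSum (δ := 0) zero_le_one (fun i => pole 0 (s.get i)) b (by
    intro n
    refine le_trans ?_ (hb n)
    rw [hofFn, List.map_ofFn]
    refine nestedSum_zero_le_one (fun u hu k => ?_) n
    obtain ⟨i, rfl⟩ := List.mem_ofFn.1 hu
    exact norm_nonneg _)).2
  rw [hofFn]
  convert h using 2
  rw [mzv, Complex.ofReal_tsum,
    ← (positiveTuplesEquiv 0 StrictAnti strictAnti_add_one_iff).tsum_eq]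
  refine tsum_congr fun k => ?_
  simp [positiveTuplesEquiv, pole]

section Reduction

variable {K : Type*} [Field K] [Algebra K ℂ]

variable (K) in
/-- The bilinear map sending `h` and `G` to the sequence `n ↦ ∑ k < n, h k * G (k + 1)`. -/
noncomputable def innerSum : (ℕ → ℂ) →ₗ[K] (ℕ → ℂ) →ₗ[K] (ℕ → ℂ) :=
  LinearMap.mk₂ K (fun h G n => ∑ k ∈ Finset.range n, h k * G (k + 1))
    (fun h h' G => by funext n; simp [add_mul, Finset.sum_add_distrib])
    (fun c h G => by funext n; simp [Finset.smul_sum])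
    (fun h G G' => by funext n; simp [mul_add, Finset.sum_add_distrib])
    (fun c h G => by
      funext n
      simp only [algebra_smul_apply, Finset.mul_sum]
      exact Finset.sum_congr rfl fun k _ => by ring)

theorem innerSum_apply (h G : ℕ → ℂ) (n : ℕ) :
    innerSum K h G n = ∑ k ∈ Finset.range n, h k * G (k + 1) := rfl

theorem nestedSum_cons (δ : ℕ) (f : ℕ → ℂ) (L : List (ℕ → ℂ)) (n : ℕ) :
    nestedSum δ (f :: L) n = ∑ k ∈ Finset.range n, f k * nestedSum δ L (k + δ) := rfl

theorem nestedSum_one_cons (h : ℕ → ℂ) (L : List (ℕ → ℂ)) :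
    nestedSum 1 (h :: L) = innerSum K h (nestedSum 1 L) := rfl

theorem innerSum_pole_nestedSum_zero (a b : ℕ) (t : List ℕ) :
    innerSum K (pole 0 a) (nestedSum 0 ((b :: t).map (pole 0)))
      = nestedSum 0 ((a :: b :: t).map (pole 0))
        + nestedSum 0 (((a + b) :: t).map (pole 0)) := by
  funext n
  rw [innerSum_apply, Pi.add_apply]
  simp only [List.map_cons]
  rw [nestedSum_cons 0 (pole 0 a), nestedSum_cons 0 (pole 0 (a + b)), ← Finset.sum_add_distrib]
  refine Finset.sum_congr rfl fun k _ => ?_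
  rw [nestedSum_cons, nestedSum_cons, Finset.sum_range_succ]
  simp only [add_zero]
  have : pole 0 (a + b) k = pole 0 a k * pole 0 b k := by
    simp only [pole, pow_add, mul_inv]
  rw [this]
  ring

theorem nestedSum_one_sub_zero_mem (a : ℕ) (s : List ℕ) (hs : ∀ b ∈ a :: s, 1 ≤ b) :
    nestedSum 1 ((a :: s).map (pole 0)) - nestedSum 0 ((a :: s).map (pole 0)) ∈
      Submodule.span K ((fun t : List ℕ => nestedSum 0 (t.map (pole 0))) ''
        {t | (∀ b ∈ t, 1 ≤ b) ∧ a ≤ t.headI ∧ t ≠ [] ∧ t.length ≤ s.length}) := by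
  induction s generalizing a with
  | nil =>
    have : nestedSum 1 ([a].map (pole 0)) - nestedSum 0 ([a].map (pole 0)) = 0 := by
      funext n
      simp [nestedSum]
    rw [this]
    exact zero_mem _
  | cons b s ih =>
    have ha : 1 ≤ a := hs a (by simp)
    have hbs : ∀ c ∈ b :: s, 1 ≤ c := fun c hc => hs c (by simp [List.mem_cons.1 hc])
    have h1 := ih b hbs
    set w := nestedSum 1 ((b :: s).map (pole 0)) - nestedSum 0 ((b :: s).map (pole 0)) with hw
    have h2 : nestedSum 1 ((b :: s).map (pole 0)) = nestedSum 0 ((b :: s).map (pole 0)) + w := by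
      rw [hw]; abel
    have h3 : nestedSum 1 ((a :: b :: s).map (pole 0))
        = innerSum K (pole 0 a) (nestedSum 1 ((b :: s).map (pole 0))) := rfl
    have gen : ∀ (c : ℕ) (t : List ℕ), (∀ x ∈ c :: t, 1 ≤ x) → t.length ≤ s.length →
        nestedSum 0 (((a + c) :: t).map (pole 0)) ∈
          Submodule.span K ((fun t : List ℕ => nestedSum 0 (t.map (pole 0))) ''
            {t | (∀ b ∈ t, 1 ≤ b) ∧ a ≤ t.headI ∧ t ≠ [] ∧ t.length ≤ (b :: s).length}) := by
      intro c t hct hlen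
      refine Submodule.subset_span ⟨(a + c) :: t, ⟨fun x hx => ?_, ?_, by simp, ?_⟩, rfl⟩
      · rcases List.mem_cons.1 hx with rfl | hx
        · omega
        · exact hct x (by simp [hx])
      · simp
      · simpa using hlen
    rw [h3, h2, map_add, innerSum_pole_nestedSum_zero, add_assoc, add_sub_cancel_left]
    refine Submodule.add_mem _ (gen b s hbs le_rfl) ?_
    refine Submodule.mem_comap.1 (Submodule.span_le.2 ?_ h1)
    rintro _ ⟨t, ⟨ht1, -, ht0, ht2⟩, rfl⟩
    cases t with
    | nil => exact absurd rfl ht0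
    | cons c t =>
      simp only [Submodule.comap_coe, Set.mem_preimage, SetLike.mem_coe]
      rw [innerSum_pole_nestedSum_zero]
      refine Submodule.add_mem _ (Submodule.subset_span ⟨a :: c :: t, ⟨fun x hx => ?_, ?_, by simp,
        ?_⟩, rfl⟩) (gen c t ht1 ?_)
      · rcases List.mem_cons.1 hx with rfl | hx
        · exact ha
        · exact ht1 x hx
      · simp
      · simpa using ht2
      · simp at ht2; omega

/-- The sequences converging to an element of `V`. -/
def limSpan (V : Submodule K ℂ) : Submodule K (ℕ → ℂ) where
  carrier := {G | ∃ z ∈ V, Tendsto G atTop (𝓝 z)}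
  add_mem' := by
    rintro G H ⟨z, hz, hG⟩ ⟨w, hw, hH⟩
    exact ⟨z + w, V.add_mem hz hw, hG.add hH⟩
  zero_mem' := ⟨0, V.zero_mem, tendsto_const_nhds⟩
  smul_mem' := by
    rintro c G ⟨z, hz, hG⟩
    refine ⟨c • z, V.smul_mem c hz, ?_⟩
    rw [Algebra.smul_def c z]
    exact (hG.const_mul (algebraMap K ℂ c)).congr fun n => (algebra_smul_apply c G n).symm

theorem limSpan_mono {V W : Submodule K ℂ} (h : V ≤ W) : limSpan V ≤ limSpan W :=
  fun _ ⟨z, hz, hG⟩ => ⟨z, h hz, hG⟩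

variable (K) in
/-- The span of the multiple zeta values with indices in `Q`. -/
noncomputable def mzvSpan (Q : Set (List ℕ)) : Submodule K ℂ :=
  Submodule.span K ((fun s => (mzv s : ℂ)) '' {s | IsAdmissible s ∧ s ∈ Q})

theorem mzvSpan_mono {Q Q' : Set (List ℕ)} (h : Q ⊆ Q') : mzvSpan K Q ≤ mzvSpan K Q' :=
  Submodule.span_mono (Set.image_mono fun _ hs => ⟨hs.1, h hs.2⟩)

theorem nestedSum_zero_mem_limSpan {Q : Set (List ℕ)} {s : List ℕ} (hs : IsAdmissible s)
    (hQ : s ∈ Q) : nestedSum 0 (s.map (pole 0)) ∈ limSpan (mzvSpan K Q) :=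
  ⟨_, Submodule.subset_span ⟨s, ⟨hs, hQ⟩, rfl⟩, tendsto_nestedSum_zero_poles hs⟩

theorem nestedSum_one_mem_limSpan {s : List ℕ} (hs : IsAdmissible s) :
    nestedSum 1 (s.map (pole 0)) ∈ limSpan (mzvSpan K {t | t.length < s.length ∨ t = s}) := by
  cases s with
  | nil => exact nestedSum_zero_mem_limSpan hs (Or.inr rfl)
  | cons a s =>
    have h := nestedSum_one_sub_zero_mem (K := K) a s hs.1
    rw [← sub_add_cancel (nestedSum 1 ((a :: s).map (pole 0)))
      (nestedSum 0 ((a :: s).map (pole 0)))]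
    refine Submodule.add_mem _ (Submodule.span_le.2 ?_ h)
      (nestedSum_zero_mem_limSpan hs (Or.inr rfl))
    rintro _ ⟨t, ⟨ht1, hta, -, htl⟩, rfl⟩
    have h2 : 2 ≤ a := hs.2 (by simp)
    exact nestedSum_zero_mem_limSpan ⟨ht1, fun _ => h2.trans hta⟩
      (Or.inl (Nat.lt_succ_of_le htl))

theorem innerSum_diffOp_innerSum (g f H : ℕ → ℂ) :
    innerSum K (diffOp K g) (innerSum K f H) = g * innerSum K f H - innerSum K (g * f) H := by
  funext n
  induction n with
  | zero => simp [innerSum_apply]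
  | succ n ih =>
    simp only [innerSum_apply, Pi.sub_apply, Pi.mul_apply, diffOp_apply] at ih ⊢
    rw [Finset.sum_range_succ, ih, Finset.sum_range_succ _ n, Finset.sum_range_succ _ n]
    ring

theorem innerSum_diffOp_one (g : ℕ → ℂ) :
    innerSum K (diffOp K g) 1 = g - fun _ => g 0 := by
  funext n
  simp only [innerSum_apply, diffOp_apply, Pi.one_apply, mul_one, Pi.sub_apply]
  exact Finset.sum_range_sub g n

theorem innerSum_mul (h g G : ℕ → ℂ) :
    innerSum K h (g * G) = innerSum K (h * fun k => g (k + 1)) G := by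
  funext n
  simp [innerSum_apply, mul_assoc]

variable (K) in
/-- The operation of prepending the reversed list of summands to a nested sum. -/
noncomputable def prepend : List (ℕ → ℂ) → (ℕ → ℂ) →ₗ[K] (ℕ → ℂ)
  | [] => LinearMap.id
  | h :: L => prepend L ∘ₗ innerSum K h

theorem prepend_nestedSum (L M : List (ℕ → ℂ)) :
    prepend K L (nestedSum 1 M) = nestedSum 1 (L.reverse ++ M) := by
  induction L generalizing M with
  | nil => rfl
  | cons h L ih =>
    rw [prepend, LinearMap.comp_apply, ← nestedSum_one_cons, ih]
    simp

theorem tendsto_mul_nestedSum_poles {g : ℕ → ℂ} (hg : g ∈ ratSpan K (-1)) {s : List ℕ}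
    (hs : ∀ a ∈ s, 1 ≤ a) : Tendsto (g * nestedSum 1 (s.map (pole 0))) atTop (𝓝 0) := by
  obtain ⟨-, C, hC, hgC⟩ := hasGrowth_of_mem_ratSpan hg
  obtain ⟨C', hC', h'⟩ := zpow_mul_nestedSum_le
    (s.map fun a => (fun k => ‖pole 0 a k‖, -(a : ℤ))) (-1) (by
      intro u hu
      obtain ⟨a, -, rfl⟩ := List.mem_map.1 hu
      exact hasGrowth_pole a) (by
      intro l hl
      rw [List.map_map] at hl
      obtain ⟨t, ht, rfl⟩ := List.prefix_map_iff.1 hl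
      obtain ⟨w, rfl⟩ := ht
      have h1 := sum_map_neg_add_one_le (s := t) fun b hb => hs b (by simp [hb])
      simp only [Function.comp_def] at h1 ⊢
      omega)
  rw [← tendsto_add_atTop_iff_nat 1]
  refine squeeze_zero_norm (a := fun n : ℕ => C * C' * (√((n : ℝ) + 1))⁻¹) (fun n => ?_) ?_
  · have h1 := norm_nestedSum_le (δ := 1) (s.map (pole 0)) (n + 1)
    have h2 := h' n
    simp only [neg_add_cancel, zpow_zero, one_mul, List.map_map, Function.comp_def] at h1 h2
    have h3 := hgC (n + 1)
    have hn : (0 : ℝ) < (n : ℝ) + 1 := by positivity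
    have h4 : (((n + 1 : ℕ) : ℝ) + 1) ^ (-1 : ℤ) ≤ ((n : ℝ) + 1)⁻¹ := by
      rw [zpow_neg_one]
      push_cast
      gcongr
      linarith
    have h5 : ((n : ℝ) + 1)⁻¹ * √((n : ℝ) + 1) = (√((n : ℝ) + 1))⁻¹ := by
      have hs : (0 : ℝ) < √((n : ℝ) + 1) := Real.sqrt_pos.2 hn
      rw [inv_mul_eq_iff_eq_mul₀ hn.ne', eq_mul_inv_iff_mul_eq₀ hs.ne', Real.mul_self_sqrt hn.le]
    rw [Pi.mul_apply, norm_mul]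
    calc ‖g (n + 1)‖ * ‖nestedSum 1 (s.map (pole 0)) (n + 1)‖
        ≤ (C * ((n : ℝ) + 1)⁻¹) * (C' * √((n : ℝ) + 1)) := by
          have := h1.trans h2
          have := h3.trans (mul_le_mul_of_nonneg_left h4 hC)
          gcongr
      _ = C * C' * (√((n : ℝ) + 1))⁻¹ := by rw [← h5]; ring
  · rw [← mul_zero (C * C')]
    refine Tendsto.const_mul _ (tendsto_inv_atTop_zero.comp (Real.tendsto_sqrt_atTop.comp ?_))
    exact tendsto_atTop_add_const_right _ _ tendsto_natCast_atTop_atTop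

end Reduction

end ZetaLimits

section MainInduction

open Filter Topology

variable {K : Type*} [Field K] [Algebra K ℂ]

/-- The lists obtained by choosing exponents `u` in the sets attached to the reversed list `R` of
summands and appending `s`, together with all strictly shorter lists. -/
def reachable (R : List ((ℕ → ℂ) × ℤ × Set ℕ)) (s : List ℕ) : Set (List ℕ) :=
  {t | t.length < R.length + s.length ∨
    ∃ u, List.Forall₂ (fun a x => a ∈ x.2.2) u R ∧ t = u.reverse ++ s}

theorem length_le_of_mem_reachable {R : List ((ℕ → ℂ) × ℤ × Set ℕ)} {s t : List ℕ}
    (h : t ∈ reachable R s) : t.length ≤ R.length + s.length := by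
  rcases h with h | ⟨u, hu, rfl⟩
  · exact h.le
  · rw [List.length_append, List.length_reverse, hu.length_eq]

theorem reachable_subset_of_lt {R R' : List ((ℕ → ℂ) × ℤ × Set ℕ)} {s s' : List ℕ}
    (h : R'.length + s'.length < R.length + s.length) : reachable R' s' ⊆ reachable R s :=
  fun _ ht => Or.inl ((length_le_of_mem_reachable ht).trans_lt h)

theorem reachable_cons_subset {x : (ℕ → ℂ) × ℤ × Set ℕ} {R : List ((ℕ → ℂ) × ℤ × Set ℕ)}
    {s : List ℕ} {t : ℕ} (ht : t ∈ x.2.2) : reachable R (t :: s) ⊆ reachable (x :: R) s := by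
  rintro w (hw | ⟨u, hu, rfl⟩)
  · left
    simp only [List.length_cons] at hw ⊢
    omega
  · right
    exact ⟨t :: u, List.Forall₂.cons ht hu, by simp⟩

variable (K) in
/-- A summand with its degree bound and the set of exponents of its leading part. -/
def IsSummand (x : (ℕ → ℂ) × ℤ × Set ℕ) : Prop :=
  x.1 ∈ ratSpan K x.2.1 ∧ x.1 ∈ decSpan K x.2.2 (max (x.2.1 + 1) (-1)) ∧ ∀ t ∈ x.2.2, 1 ≤ t

theorem isSummand_of_mem_ratSpan [CharZero K] {f : ℕ → ℂ} {d : ℤ} (hf : f ∈ ratSpan K d) :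
    IsSummand K (f, d, {s | 1 ≤ s}) :=
  ⟨hf, ratSpan_le_decSpan d hf, fun _ ht => ht⟩

/-- The convergence condition on the reversed list of degrees. -/
def IsConvergent (D : List ℤ) : Prop :=
  ∀ l, l <:+ D → l ≠ [] → (l.map (· + 1)).sum ≤ -1

theorem isConvergent_cons {d : ℤ} {D : List ℤ} :
    IsConvergent (d :: D) ↔ d + 1 + (D.map (· + 1)).sum ≤ -1 ∧ IsConvergent D := by
  constructor
  · intro h
    exact ⟨by simpa using h (d :: D) List.suffix_rfl (by simp),
      fun l hl hne => h l (hl.trans (List.suffix_cons _ _)) hne⟩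
  · rintro ⟨h1, h2⟩ l hl hne
    rcases List.suffix_cons_iff.1 hl with rfl | hl
    · simpa using h1
    · exact h2 l hl hne

theorem IsConvergent.sum_le {D : List ℤ} (h : IsConvergent D) (hD : D ≠ []) :
    (D.map (· + 1)).sum ≤ -1 :=
  h D List.suffix_rfl hD

theorem prepend_mem_limSpan [CharZero K] (R : List ((ℕ → ℂ) × ℤ × Set ℕ)) (s : List ℕ)
    (hR : ∀ x ∈ R, IsSummand K x) (hD : IsConvergent (R.map fun x => x.2.1))
    (hs : ∀ a ∈ s, 1 ≤ a) (hRs : R = [] → IsAdmissible s) :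
    prepend K (R.map Prod.fst) (nestedSum 1 (s.map (pole 0)))
      ∈ limSpan (mzvSpan K (reachable R s)) := by
  induction hN : 2 * R.length + s.length using Nat.strong_induction_on generalizing R s with
  | _ N ih =>
  cases R with
  | nil =>
    refine limSpan_mono (mzvSpan_mono ?_) (nestedSum_one_mem_limSpan (hRs rfl))
    rintro t (ht | rfl)
    · exact Or.inl (by simpa using ht)
    · exact Or.inr ⟨[], List.Forall₂.nil, rfl⟩
  | cons x R =>
    obtain ⟨f, d, B⟩ := x
    have hR' : ∀ x ∈ R, IsSummand K x := fun x hx => hR x (by simp [hx])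
    obtain ⟨hf, hfB, hB⟩ := hR (f, d, B) (by simp)
    simp only at hf hfB hB
    rw [List.map_cons, isConvergent_cons] at hD
    obtain ⟨hd, hD'⟩ := hD
    simp only at hd
    obtain ⟨B', hB', hfB', hhead⟩ : ∃ B' ⊆ B, f ∈ decSpan K B' (max (d + 1) (-1)) ∧
        (R = [] → ∀ t ∈ B', 2 ≤ t) := by
      by_cases hRn : R = []
      · subst hRn
        have hd2 : d ≤ -2 := by simp at hd; omega
        have hm : max (d + 1) (-1) = -1 := by omega
        rw [hm] at hfB ⊢
        refine ⟨B \ {1}, Set.sdiff_subset, mem_decSpan_diff_one hB hd2 hf hfB, fun _ t ht => ?_⟩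
        have h1 := hB t ht.1
        have h2 : t ≠ 1 := ht.2
        omega
      · exact ⟨B, subset_rfl, hfB, fun h => absurd h hRn⟩
    set γ : ℤ := max (d + 1) (-1) with hγ
    set G := nestedSum 1 (s.map (pole 0)) with hG
    set V := limSpan (mzvSpan K (reachable ((f, d, B) :: R) s)) with hV
    have lower : ∀ (R' : List ((ℕ → ℂ) × ℤ × Set ℕ)) (s' : List ℕ),
        (∀ x ∈ R', IsSummand K x) → IsConvergent (R'.map fun x => x.2.1) →
        (∀ a ∈ s', 1 ≤ a) → (R' = [] → IsAdmissible s') →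
        R'.length ≤ R.length + 1 → R'.length + s'.length < R.length + 1 + s.length →
        prepend K (R'.map Prod.fst) (nestedSum 1 (s'.map (pole 0))) ∈ V := by
      intro R' s' h1 h2 h3 h4 h5 h6
      refine limSpan_mono (mzvSpan_mono (reachable_subset_of_lt (by simpa using h6)))
        (ih _ ?_ R' s' h1 h2 h3 h4 rfl)
      simp only [List.length_cons] at hN
      omega
    obtain ⟨y, hy, _, ⟨g, hg, rfl⟩, rfl⟩ := Submodule.mem_sup.1 hfB'
    rw [List.map_cons, prepend, LinearMap.comp_apply, map_add, LinearMap.add_apply, map_add]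
    refine Submodule.add_mem _ ?_ ?_
    · have : y ∈ V.comap (prepend K (R.map Prod.fst) ∘ₗ (innerSum K).flip G) := by
        refine Submodule.span_le.2 ?_ hy
        rintro _ ⟨t, ht, rfl⟩
        have ht1 := hB t (hB' ht)
        have hts : ∀ a ∈ t :: s, 1 ≤ a := by
          intro a ha
          rcases List.mem_cons.1 ha with rfl | ha
          · exact ht1
          · exact hs a ha
        have key := ih _ (by simp only [List.length_cons] at hN ⊢; omega) R (t :: s) hR' hD'
          hts (fun h => ⟨hts, fun _ => hhead h t ht⟩) rfl
        exact limSpan_mono (mzvSpan_mono (reachable_cons_subset (hB' ht))) key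
      exact this
    · change prepend K (R.map Prod.fst) (innerSum K (diffOp K g) G) ∈ V
      have hgG : prepend K (R.map Prod.fst) (g * G) ∈ V := by
        cases R with
        | nil =>
          have hγ1 : γ = -1 := by simp at hd; omega
          rw [hγ1] at hg
          exact ⟨0, zero_mem _, tendsto_mul_nestedSum_poles hg hs⟩
        | cons x R =>
          obtain ⟨f', d', B''⟩ := x
          have hf' := (hR' (f', d', B'') (by simp)).1
          simp only at hf'
          rw [List.map_cons, isConvergent_cons] at hD'
          rw [List.map_cons, prepend, LinearMap.comp_apply, innerSum_mul]
          have := lower ((f' * fun k => g (k + 1), d' + γ, {s | 1 ≤ s}) :: R) s (by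
            intro x hx
            rcases List.mem_cons.1 hx with rfl | hx
            · exact isSummand_of_mem_ratSpan (mul_mem_ratSpan hf' (shift_mem_ratSpan hg))
            · exact hR' x (by simp [hx])) (by
            rw [List.map_cons, isConvergent_cons]
            refine ⟨?_, hD'.2⟩
            have h1 := hD'.1
            simp only [List.map_cons, List.sum_cons] at hd h1 ⊢
            by_cases hRn : R = []
            · subst hRn
              simp at hd h1 ⊢
              omega
            · have h2 := hD'.2.sum_le (by simpa using hRn)
              omega) hs (by simp) (by simp) (by simp)
          exact this
      cases s with
      | nil =>
        have hG1 : G = 1 := rfl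
        obtain ⟨c, hc⟩ := exists_algebraMap_eq_of_mem_ratSpan hg 0
        have hg0 : (fun _ : ℕ => g 0) = c • (1 : ℕ → ℂ) := by
          funext n
          rw [algebra_smul_apply, hc, Pi.one_apply, mul_one]
        rw [hG1, innerSum_diffOp_one, hg0, map_sub, map_smul]
        rw [hG1, mul_one] at hgG
        refine Submodule.sub_mem _ hgG (Submodule.smul_mem _ _ ?_)
        exact lower R [] hR' hD' hs (fun _ => ⟨hs, by simp⟩) (by simp) (by simp)
      | cons a s =>
        have ha : 1 ≤ a := hs a (by simp)
        have hGa : G = innerSum K (pole 0 a) (nestedSum 1 (s.map (pole 0))) := rfl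
        rw [hGa, innerSum_diffOp_innerSum, ← hGa, map_sub]
        refine Submodule.sub_mem _ hgG ?_
        have := lower ((g * pole 0 a, γ + -(a : ℤ), {s | 1 ≤ s}) :: R) s (by
          intro x hx
          rcases List.mem_cons.1 hx with rfl | hx
          · exact isSummand_of_mem_ratSpan (mul_mem_ratSpan hg (pole_mem_ratSpan 0 a))
          · exact hR' x hx) (by
          rw [List.map_cons, isConvergent_cons]
          refine ⟨?_, hD'⟩
          by_cases hRn : R = []
          · subst hRn
            simp at hd ⊢
            omega
          · have h2 := hD'.sum_le (by simpa using hRn)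
            simp only
            omega) (fun b hb => hs b (by simp [hb])) (by simp) (by simp) (by simp)
        exact this

end MainInduction

section ShiftedPolynomial

open MvPolynomial

variable {K : Type*} [Field K] {σ : Type*} [Fintype σ]

theorem degreeOf_bind₁_X_sub_C_le (a : σ → K) (P : MvPolynomial σ K) (i : σ) :
    (bind₁ (fun j => X j - C (a j)) P).degreeOf i ≤ P.degreeOf i := by
  classical
  rw [bind₁, aeval_def, eval₂_eq']
  refine (degreeOf_sum_le _ _ _).trans (Finset.sup_le fun m hm => ?_)
  rw [algebraMap_eq]
  refine (degreeOf_C_mul_le _ _ _).trans ((degreeOf_prod_le _ _ _).trans ?_)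
  refine le_trans ?_ (monomial_le_degreeOf i hm)
  calc ∑ j, ((X j - C (a j) : MvPolynomial σ K) ^ m j).degreeOf i
      ≤ ∑ j, if j = i then m j else 0 := by
        refine Finset.sum_le_sum fun j _ => (degreeOf_pow_le _ _ _).trans ?_
        have h : (X j - C (a j) : MvPolynomial σ K).degreeOf i ≤ if j = i then 1 else 0 := by
          refine (degreeOf_sub_le _ _ _).trans ?_
          rw [degreeOf_C, degreeOf_X]
          simp [eq_comm]
        refine (Nat.mul_le_mul_left _ h).trans ?_
        split_ifs <;> simp
    _ = m i := by simp

theorem neg_one_pow_eq_of_aeval_update [CharZero K] (Q : MvPolynomial σ K) [DecidableEq σ] (i : σ)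
    (ε : K) (h : ∀ v : σ → K, eval (Function.update v i (-v i)) Q = ε * eval v Q)
    {m : σ →₀ ℕ} (hm : m ∈ Q.support) : (-1) ^ m i = ε := by
  set Q' : MvPolynomial σ K := ∑ l ∈ Q.support, monomial l ((-1) ^ l i * coeff l Q) with hQ'
  have h1 : Q' = C ε * Q := by
    refine MvPolynomial.funext fun v => ?_
    rw [map_mul, eval_C, ← h v, hQ', map_sum, eval_eq' (Function.update v i (-v i))]
    refine Finset.sum_congr rfl fun l _ => ?_
    rw [eval_monomial, Finsupp.prod_fintype _ _ (by simp),
      ← Finset.mul_prod_erase _ _ (Finset.mem_univ i),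
      ← Finset.mul_prod_erase (Finset.univ) (fun j => Function.update v i (-v i) j ^ l j)
        (Finset.mem_univ i), Function.update_self, neg_pow (v i)]
    have : ∏ j ∈ Finset.univ.erase i, Function.update v i (-v i) j ^ l j
        = ∏ j ∈ Finset.univ.erase i, v j ^ l j :=
      Finset.prod_congr rfl fun j hj => by
        rw [Function.update_of_ne (Finset.ne_of_mem_erase hj)]
    rw [this]
    ring
  have h2 : coeff m Q' = (-1) ^ m i * coeff m Q := by
    rw [hQ', coeff_sum]
    simp only [coeff_monomial]
    rw [Finset.sum_ite_eq' Q.support m, if_pos hm]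
  rw [h1, coeff_C_mul] at h2
  exact (mul_right_cancel₀ (mem_support_iff.1 hm) h2).symm

end ShiftedPolynomial

section TupleSums

variable {K : Type*} [Field K] [Algebra K ℂ] {p : ℕ}

theorem sum_prefix_ofFn_le {d : Fin p → ℤ} (hd : ∀ j, ∑ i ∈ Finset.Iic j, (d i + 1) ≤ -1)
    {l : List ℤ} (hl : l <+: List.ofFn d) (hne : l ≠ []) : (l.map (· + 1)).sum ≤ -1 := by
  have hlen : l.length ≤ p := by simpa using hl.length_le
  have hpos : 0 < l.length := List.length_pos_iff.2 hne
  rw [List.prefix_iff_eq_take.1 hl, List.map_take, List.map_ofFn, List.sum_take_ofFn]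
  refine le_of_eq_of_le (Finset.sum_congr ?_ fun _ _ => rfl) (hd ⟨l.length - 1, by omega⟩)
  ext i
  simp only [Finset.mem_filter, Finset.mem_univ, true_and, Finset.mem_Iic, Fin.le_def]
  omega

theorem tsum_mem_mzvSpan [CharZero K] (F : Fin p → ℕ → ℂ) (d : Fin p → ℤ) (B : Fin p → Set ℕ)
    (hF : ∀ i, IsSummand K (F i, d i, B i)) (hd : ∀ j, ∑ i ∈ Finset.Iic j, (d i + 1) ≤ -1) :
    Summable (fun k : {k : Fin p → ℕ // IsNested 1 k} => ∏ i, F i (k.1 i)) ∧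
    ∑' k : {k : Fin p → ℕ // IsNested 1 k}, ∏ i, F i (k.1 i) ∈
      mzvSpan K {t | t.length < p ∨ ∃ u : Fin p → ℕ, (∀ i, u i ∈ B i) ∧ t = List.ofFn u} := by
  obtain ⟨b, hb⟩ := nestedSum_le_of_growth (List.ofFn fun i => ((fun k => ‖F i k‖), d i)) (by
    intro u hu
    obtain ⟨i, rfl⟩ := List.mem_ofFn.1 hu
    exact hasGrowth_of_mem_ratSpan (hF i).1) (by
    intro l hl hne
    rw [List.map_ofFn] at hl
    exact sum_prefix_ofFn_le hd hl hne)
  rw [List.map_ofFn] at hb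
  obtain ⟨hsum, hlim⟩ := tendsto_nestedSum le_rfl F b hb
  refine ⟨hsum, ?_⟩
  set R := (List.ofFn fun i => (F i, d i, B i)).reverse with hR
  have hmem := prepend_mem_limSpan (K := K) R [] (by
    intro x hx
    rw [hR, List.mem_reverse] at hx
    obtain ⟨i, rfl⟩ := List.mem_ofFn.1 hx
    exact hF i) (by
    intro l hl hne
    rw [hR, List.map_reverse, List.map_ofFn, ← List.reverse_prefix, List.reverse_reverse] at hl
    have := sum_prefix_ofFn_le hd hl (by simpa using hne)
    rwa [List.map_reverse, List.sum_reverse] at this) (by simp) (fun _ => ⟨by simp, by simp⟩)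
  rw [List.map_nil, prepend_nestedSum, List.append_nil, hR, List.map_reverse, List.reverse_reverse,
    List.map_ofFn] at hmem
  obtain ⟨z, hz, hz'⟩ := hmem
  rw [tendsto_nhds_unique hlim hz']
  refine mzvSpan_mono ?_ hz
  rintro t (ht | ⟨u, hu, rfl⟩)
  · exact Or.inl (by simpa using ht)
  · right
    rw [← List.reverse_reverse u, List.forall₂_reverse_iff, List.forall₂_iff_get] at hu
    obtain ⟨hlen, hu⟩ := hu
    rw [List.length_ofFn] at hlen
    refine ⟨fun i => u.reverse.get (Fin.cast hlen.symm i), fun i => ?_, ?_⟩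
    · simpa using hu i (by rw [hlen]; exact i.2) (by simp)
    · rw [List.append_nil]
      refine List.ext_get (by simpa using hlen) fun j h1 h2 => ?_
      simp

end TupleSums

theorem int_emod_two_eq_of_even {m N s : ℕ} {e : ℤ} (h : (-1 : ℂ) ^ m = (-1) ^ ((N : ℤ) + e))
    (hs : Even (m + N + s)) : (s : ℤ) % 2 = e % 2 := by
  have hm : Even (m : ℤ) ↔ Even ((N : ℤ) + e) := by
    rw [← zpow_natCast] at h
    have hne : (1 : ℂ) ≠ -1 := by norm_num
    rcases Int.even_or_odd (m : ℤ) with h1 | h1 <;>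
      rcases Int.even_or_odd ((N : ℤ) + e) with h2 | h2
    · exact iff_of_true h1 h2
    · rw [h1.neg_one_zpow, h2.neg_one_zpow] at h
      exact absurd h hne
    · rw [h1.neg_one_zpow, h2.neg_one_zpow] at h
      exact absurd h.symm hne
    · exact iff_of_false (Int.not_even_iff_odd.2 h1) (Int.not_even_iff_odd.2 h2)
  rw [Int.even_iff, Int.even_iff] at hm
  rw [Nat.even_iff] at hs
  omega

theorem statement11 (p : ℕ) (hp : 0 < p) (A n r : ℕ → ℕ) (K : Subfield ℂ)
    (P : MvPolynomial (Fin p) K)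
    (h9 : ∀ j : Fin p, (∑ i ∈ Finset.Iic j, P.degreeOf i) + j.1 + 2 ≤
      ∑ i ∈ Finset.Iic j, A i.1 * (n i.1 + 1))
    (e : Fin p → ℤ)
    (hsym : ∀ i : Fin p, ∀ k : Fin p → ℂ,
      MvPolynomial.eval₂ K.subtype
          (Function.update k i (-(k i) - 2 * (r i.1 : ℂ) - (n i.1 : ℂ))) P
        = (-1 : ℂ) ^ (((A i.1 * (n i.1 + 1) : ℕ) : ℤ) + e i) *
            MvPolynomial.eval₂ K.subtype k P) :
    Summable (fun k : {k : Fin p → ℕ // Antitone k ∧ ∀ i, 1 ≤ k i} =>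
        Rfun p K A n r P (fun i => (k.1 i : ℂ))) ∧
    ∃ (T : Finset (List ℕ)) (c : List ℕ → K),
      (∀ s ∈ T, s.length ≤ p ∧ (∀ a ∈ s, 1 ≤ a) ∧ (s ≠ [] → 2 ≤ s.headI) ∧
        ∀ hs : s.length = p, ∀ i : Fin p,
          1 ≤ s.get (Fin.cast hs.symm i) ∧ s.get (Fin.cast hs.symm i) ≤ A i.1 ∧
            ((s.get (Fin.cast hs.symm i) : ℤ) % 2 = e i % 2)) ∧
      (∑' k : {k : Fin p → ℕ // Antitone k ∧ ∀ i, 1 ≤ k i},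
          Rfun p K A n r P (fun i => (k.1 i : ℂ)))
        = ∑ s ∈ T, (c s : ℂ) * (mzv s : ℂ) := by
  classical
  set a : Fin p → K := fun i => (r i.1 : K) + (n i.1 : K) / 2 with ha
  have haC : ∀ i, ((a i : K) : ℂ) = (r i.1 : ℂ) + (n i.1 : ℂ) / 2 := fun i => by
    have h2 : ((2 : K) : ℂ) = 2 := map_ofNat K.subtype 2
    simp [ha, h2]
  set Q := MvPolynomial.bind₁ (fun j => MvPolynomial.X j - MvPolynomial.C (a j)) P with hQ
  have hQeval : ∀ v : Fin p → ℂ,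
      MvPolynomial.eval₂ K.subtype v Q = MvPolynomial.eval₂ K.subtype (fun i => v i - a i) P := by
    intro v
    have : MvPolynomial.aeval v Q = MvPolynomial.aeval (fun i => v i - (a i : ℂ)) P := by
      rw [hQ, MvPolynomial.aeval_bind₁]
      congr 2
      funext i
      rw [map_sub, MvPolynomial.aeval_X, MvPolynomial.aeval_C]
      rfl
    exact this
  have hQeval' : ∀ v : Fin p → K,
      ((MvPolynomial.eval v Q : K) : ℂ) = MvPolynomial.eval₂ K.subtype (fun i => (v i : ℂ)) Q := by
    intro v
    exact (MvPolynomial.eval₂_comp K.subtype v Q).trans rfl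
  have hpar : ∀ m ∈ Q.support, ∀ i : Fin p,
      (-1 : ℂ) ^ m i = (-1) ^ (((A i.1 * (n i.1 + 1) : ℕ) : ℤ) + e i) := by
    intro m hm i
    have h := neg_one_pow_eq_of_aeval_update Q i
      ((-1) ^ (((A i.1 * (n i.1 + 1) : ℕ) : ℤ) + e i)) (fun v => by
        refine Subtype.ext ?_
        push_cast
        rw [hQeval', hQeval', hQeval, hQeval]
        have h := hsym i (fun j => (v j : ℂ) - a j)
        refine Eq.trans ?_ (h.trans ?_)
        · congr 1
          funext j
          by_cases hj : j = i
          · subst hj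
            simp only [Function.update_self, haC]
            push_cast
            ring
          · simp [Function.update_of_ne hj]
        · push_cast
          rfl) hm
    have := congrArg K.subtype h
    rwa [map_pow, map_zpow₀, map_neg, map_one] at this
  have hdeg : ∀ m ∈ Q.support, ∀ i, m i ≤ P.degreeOf i := fun m hm i =>
    (MvPolynomial.monomial_le_degreeOf i hm).trans (degreeOf_bind₁_X_sub_C_le a P i)
  set W : (Fin p →₀ ℕ) → Fin p → ℕ → ℂ := fun m i =>
    wellPoised (m i) (A i.1) (n i.1) (r i.1) with hW
  set V := mzvSpan K {t | t.length < p ∨ ∃ u : Fin p → ℕ,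
    (∀ i, 1 ≤ u i ∧ u i ≤ A i.1 ∧ (u i : ℤ) % 2 = e i % 2) ∧ t = List.ofFn u} with hV
  have hterm : ∀ m ∈ Q.support,
      Summable (fun k : {k : Fin p → ℕ // IsNested 1 k} => ∏ i, W m i (k.1 i)) ∧
      ∑' k : {k : Fin p → ℕ // IsNested 1 k}, ∏ i, W m i (k.1 i) ∈ V := by
    intro m hm
    have h := tsum_mem_mzvSpan (K := K) (W m)
      (fun i => (m i : ℤ) - (A i.1 * (n i.1 + 1) : ℕ))
      (fun i => {s | 1 ≤ s ∧ s ≤ A i.1 ∧ Even (m i + A i.1 * (n i.1 + 1) + s)})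
      (fun i => ⟨(wellPoised_mem_decSpan _ _ _ _).1, (wellPoised_mem_decSpan _ _ _ _).2,
        fun t ht => ht.1⟩) (fun j => by
        have h1 := h9 j
        have h2 : ∑ i ∈ Finset.Iic j, m i ≤ ∑ i ∈ Finset.Iic j, P.degreeOf i :=
          Finset.sum_le_sum fun i _ => hdeg m hm i
        rw [Finset.sum_add_distrib, Finset.sum_sub_distrib, ← Nat.cast_sum, ← Nat.cast_sum,
          Finset.sum_const, Fin.card_Iic, nsmul_eq_mul, mul_one]
        omega)
    refine ⟨h.1, mzvSpan_mono ?_ h.2⟩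
    rintro t (ht | ⟨u, hu, rfl⟩)
    · exact Or.inl ht
    · exact Or.inr ⟨u, fun i => ⟨(hu i).1, (hu i).2.1,
        int_emod_two_eq_of_even (hpar m hm i) (hu i).2.2⟩, rfl⟩
  have hR : ∀ k : Fin p → ℕ, Rfun p K A n r P (fun i => ((k i + 1 : ℕ) : ℂ))
      = ∑ m ∈ Q.support, ((MvPolynomial.coeff m Q : K) : ℂ) * ∏ i, W m i (k i) := by
    intro k
    have h1 : MvPolynomial.eval₂ K.subtype (fun i => ((k i + 1 : ℕ) : ℂ)) P
        = MvPolynomial.eval₂ K.subtype (fun i => (k i : ℂ) + 1 + r i.1 + n i.1 / 2) Q := by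
      rw [hQeval]
      congr 1
      funext i
      rw [haC]
      push_cast
      ring
    rw [Rfun, h1, MvPolynomial.eval₂_eq', Finset.sum_div]
    refine Finset.sum_congr rfl fun m _ => ?_
    rw [mul_div_assoc, ← Finset.prod_div_distrib]
    congr 1
    refine Finset.prod_congr rfl fun i _ => ?_
    simp only [hW, wellPoised]
    push_cast
    rfl
  set E := positiveTuplesEquiv (p := p) 1 Antitone antitone_add_one_iff with hE
  have hRE : ∀ k : {k : Fin p → ℕ // IsNested 1 k},
      Rfun p K A n r P (fun i => ((E k).1 i : ℂ))
        = ∑ m ∈ Q.support, ((MvPolynomial.coeff m Q : K) : ℂ) * ∏ i, W m i (k.1 i) :=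
    fun k => hR k.1
  have hsummable : Summable fun k : {k : Fin p → ℕ // IsNested 1 k} =>
      ∑ m ∈ Q.support, ((MvPolynomial.coeff m Q : K) : ℂ) * ∏ i, W m i (k.1 i) :=
    summable_sum fun m hm => (hterm m hm).1.mul_left _
  refine ⟨(E.summable_iff).1 (hsummable.congr fun k => (hRE k).symm), ?_⟩
  have htsum : ∑' k : {k : Fin p → ℕ // Antitone k ∧ ∀ i, 1 ≤ k i},
      Rfun p K A n r P (fun i => (k.1 i : ℂ)) ∈ V := by
    rw [← E.tsum_eq, tsum_congr hRE,
      Summable.tsum_finsetSum fun m hm => (hterm m hm).1.mul_left _]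
    refine Submodule.sum_mem _ fun m hm => ?_
    rw [tsum_mul_left]
    exact V.smul_mem (MvPolynomial.coeff m Q) (hterm m hm).2
  obtain ⟨l, hl, hlx⟩ := (Finsupp.mem_span_image_iff_linearCombination K).1 htsum
  refine ⟨l.support, l, fun s hs => ?_, ?_⟩
  · obtain ⟨hadm, hs'⟩ := (Finsupp.mem_supported K l).1 hl hs
    refine ⟨?_, hadm.1, hadm.2, fun hsp i => ?_⟩
    · rcases hs' with h | ⟨u, -, rfl⟩
      · exact h.le
      · simp
    · rcases hs' with h | ⟨u, hu, rfl⟩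
      · omega
      · simpa using hu i
  · rw [← hlx, Finsupp.linearCombination_apply]
    rfl
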